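/- arXiv:1809.01218 — 2 statements merged into one kernel-verified Lean document; each statement's English description precedes it below -/
import Mathlib

section
/- Fix positive integers a_0, b_0, positive degrees a_i (i = 1, ..., l1) and b_j (j = 1, ..., l2), and a partition of {1,...,l1} into index sets E1X, E2X and of {1,...,l2} into E1Y, E2Y. Consider the finite-dimensional complex vector space V of coefficient tuples of polynomials F ∈ ℂ[x,y] with degree at most a_0 in x and at most b_0 in y, g_i ∈ ℂ[x] with deg g_i ≤ a_i, and h_j ∈ ℂ[y] with deg h_j ≤ b_j. Then there exists a nonzero polynomial ρ on V such that whenever ρ does not vanish at the coefficient tuple of (F, g, h), the polynomial system in the variables (x, y, λ, μ) ∈ ℂ^n × ℂ^m × ℂ^{l1} × ℂ^{l2} given by: ∇_x F(x,y) = Σ_{i=1}^{l1} λ_i ∇g_i(x), ∇_y F(x,y) = Σ_{j=1}^{l2} μ_j ∇h_j(y), g_i(x) = 0 (i ∈ E1X), λ_i g_i(x) = 0 (i ∈ E2X), h_j(y) = 0 (j ∈ E1Y), μ_j h_j(y) = 0 (j ∈ E2Y), has only finitely many complex solutions (x, y, λ, μ); equivalently, there are only finitely many points (x, y) ∈ ℂ^n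 × ℂ^m admitting such multipliers. -/
open MvPolynomial

/-- Monomials in `(x, y)` of degree at most `a0` in `x` and at most `b0` in `y`. -/
abbrev XYMon (n m a0 b0 : ℕ) : Type :=
  {d : (Fin n ⊕ Fin m) →₀ ℕ // (∑ i, d (Sum.inl i)) ≤ a0 ∧ (∑ j, d (Sum.inr j)) ≤ b0}

/-- Monomials in `n` variables of total degree at most `a`. -/
abbrev XMon (n a : ℕ) : Type := {d : Fin n →₀ ℕ // (∑ i, d i) ≤ a}

/-- The critical-point (Karush–Kuhn–Tucker) polynomial system (3.3) of the saddle point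
problem, in the variables `(x, y, λ, μ) ∈ ℂⁿ × ℂᵐ × ℂ^{l1} × ℂ^{l2}`. -/
def SadSys {n m l1 l2 : ℕ} (E1X E2X : Finset (Fin l1)) (E1Y E2Y : Finset (Fin l2))
    (F : MvPolynomial (Fin n ⊕ Fin m) ℂ)
    (g : Fin l1 → MvPolynomial (Fin n) ℂ) (h : Fin l2 → MvPolynomial (Fin m) ℂ)
    (x : Fin n → ℂ) (y : Fin m → ℂ) (lam : Fin l1 → ℂ) (mu : Fin l2 → ℂ) : Prop :=
  (∀ j : Fin n, eval (Sum.elim x y) (pderiv (Sum.inl j) F) =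
      ∑ i, lam i * eval x (pderiv j (g i))) ∧
  (∀ j' : Fin m, eval (Sum.elim x y) (pderiv (Sum.inr j') F) =
      ∑ j, mu j * eval y (pderiv j' (h j))) ∧
  (∀ i ∈ E1X, eval x (g i) = 0) ∧ (∀ i ∈ E2X, lam i * eval x (g i) = 0) ∧
  (∀ j ∈ E1Y, eval y (h j) = 0) ∧ (∀ j ∈ E2Y, mu j * eval y (h j) = 0)

/-- The polynomial with coefficient `c d` at the monomial with exponent `e d`. -/
noncomputable def polyOfCoeffs {σ D R : Type} [Fintype D] [CommSemiring R]
    (e : D → σ →₀ ℕ) (c : D → R) : MvPolynomial σ R :=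
  ∑ d, monomial (e d) (c d)

theorem map_polyOfCoeffs {σ D R S : Type} [Fintype D] [CommSemiring R] [CommSemiring S]
    (e : D → σ →₀ ℕ) (c : D → R) (φ : R →+* S) :
    map φ (polyOfCoeffs e c) = polyOfCoeffs e (fun d => φ (c d)) := by
  simp [polyOfCoeffs, map_monomial]

theorem polyOfCoeffs_sub {σ D R : Type} [Fintype D] [CommRing R]
    (e : D → σ →₀ ℕ) (c c' : D → R) :
    polyOfCoeffs e c - polyOfCoeffs e c' = polyOfCoeffs e (fun d => c d - c' d) := by
  simp [polyOfCoeffs, map_sub]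

/-- A polynomial is the sum of its terms over any finite injective family of exponents
covering its support. -/
theorem polyOfCoeffs_coeff {σ D R : Type} [Fintype D] [CommSemiring R]
    (e : D → σ →₀ ℕ) (he : Function.Injective e) (F : MvPolynomial σ R)
    (hF : ∀ d ∈ F.support, d ∈ Set.range e) :
    polyOfCoeffs e (fun d => F.coeff (e d)) = F := by
  classical
  ext m
  simp only [polyOfCoeffs, coeff_sum, coeff_monomial]
  by_cases hm : m ∈ Set.range e
  · obtain ⟨d, rfl⟩ := hm
    simp [he.eq_iff]
  · have h0 : F.coeff m = 0 := by
      by_contra h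
      exact hm (hF m (mem_support_iff.2 h))
    rw [h0]
    refine Finset.sum_eq_zero fun d _ => if_neg ?_
    rintro rfl
    exact hm ⟨d, rfl⟩

/-- Evaluation of polynomials with polynomial coefficients at polynomial points. -/
theorem eval_eval_eq {σ κ R : Type} [CommSemiring R] (t : κ → R) (v : σ → MvPolynomial κ R)
    (P : MvPolynomial σ (MvPolynomial κ R)) :
    eval t (eval v P) = eval (fun k => eval t (v k)) (map (eval t) P) := by
  rw [eval_map]
  exact eval₂_comp_left (eval t) (RingHom.id _) v P

/-- A polynomial map of an affine space to itself has finite generic fibres, and so does the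
image of its fibres under any polynomial map. -/
theorem exists_ne_zero_finite_fiber {κ ι K : Type} [Finite κ] [Finite ι] [Field K]
    (q : κ → MvPolynomial κ K) (r : ι → MvPolynomial κ K) :
    ∃ ρ : MvPolynomial κ K, ρ ≠ 0 ∧ ∀ c : κ → K, eval c ρ ≠ 0 →
      {v : ι → K | ∃ t : κ → K, (∀ j, eval t (q j) = c j) ∧ ∀ k, v k = eval t (r k)}.Finite := by
  classical
  have := Fintype.ofFinite κ
  have := Fintype.ofFinite ι
  have key : ∀ k : ι, ∃ P : MvPolynomial (Option κ) K,
      P ≠ 0 ∧ aeval (fun o : Option κ => o.elim (r k) q) P = 0 := by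
    intro k
    have hdep : ¬ AlgebraicIndependent K (fun o : Option κ => o.elim (r k) q) := by
      intro h
      have h1 := h.cardinalMk_le_trdeg
      rw [MvPolynomial.trdeg_of_isDomain] at h1
      simp at h1
    rw [algebraicIndependent_iff] at hdep
    push Not at hdep
    obtain ⟨P, h1, h2⟩ := hdep
    exact ⟨P, h2, h1⟩
  choose P hP0 hP using key
  let Q : ι → Polynomial (MvPolynomial κ K) := fun k => optionEquivLeft K κ (P k)
  have hQ : ∀ k, Q k ≠ 0 := fun k => by simpa [Q] using hP0 k
  refine ⟨∏ k, (Q k).leadingCoeff, ?_, ?_⟩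
  · exact Finset.prod_ne_zero_iff.2 fun k _ => Polynomial.leadingCoeff_ne_zero.2 (hQ k)
  · intro c hc
    rw [map_prod, Finset.prod_ne_zero_iff] at hc
    have hmap : ∀ k, (Q k).map (eval c) ≠ 0 := by
      intro k h
      apply hc k (Finset.mem_univ _)
      have := congrArg (fun p => p.coeff (Q k).natDegree) h
      simpa using this
    refine (Set.Finite.pi fun k => Polynomial.rootSet_finite ((Q k).map (eval c)) K).subset ?_
    rintro v ⟨t, ht, hv⟩ k -
    rw [Polynomial.mem_rootSet]
    refine ⟨hmap k, ?_⟩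
    rw [Polynomial.coe_aeval_eq_eval, ← optionEquivLeft_elim_eval]
    have h1 := congrArg (eval t) (hP k)
    rw [map_zero, aeval_def, ← coe_eval₂Hom, map_eval₂Hom, coe_eval₂Hom] at h1
    rw [← h1, ← eval₂_id]
    congr 1
    · ext a
      simp
    · ext o
      cases o with
      | none => simp [hv k]
      | some j => simp [ht j]

/-- Critical points of a generic polynomial on the zero locus of generic polynomials, with
multipliers: here `p` assigns to each coefficient index the constraint it belongs to, `s` picks
the linear coefficients of the objective and `o` the constant coefficients of the constraints. -/
theorem exists_ne_zero_finite_critical {σ L D E K : Type} [Fintype σ] [Fintype L] [Fintype D]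
    [Fintype E] [DecidableEq L] [Field K]
    (e : D → σ →₀ ℕ) (s : σ → D) (hs : ∀ k, e (s k) = Finsupp.single k 1)
    (f : E → σ →₀ ℕ) (p : E → L) (o : L → E) (ho : ∀ i, f (o i) = 0) (hp : ∀ i, p (o i) = i)
    (A : Finset L) :
    ∃ ρ : MvPolynomial (D ⊕ E) K, ρ ≠ 0 ∧ ∀ c : D ⊕ E → K, eval c ρ ≠ 0 →
      {v : σ ⊕ L → K |
        (∀ k, eval (fun k => v (.inl k)) (pderiv k (polyOfCoeffs e fun d => c (.inl d))) =
          ∑ i, v (.inr i) * eval (fun k => v (.inl k))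
            (pderiv k (polyOfCoeffs f fun d => if p d = i then c (.inr d) else 0))) ∧
        (∀ i ∈ A, eval (fun k => v (.inl k))
          (polyOfCoeffs f fun d => if p d = i then c (.inr d) else 0) = 0) ∧
        ∀ i ∉ A, v (.inr i) = 0}.Finite := by
  classical
  have hsinj : Function.Injective s := by
    intro k k' h
    have h1 := hs k
    rw [h, hs k'] at h1
    exact (Finsupp.single_left_injective one_ne_zero h1).symm
  let Z : σ → MvPolynomial (D ⊕ E) K := fun k => X (.inl (s k))
  let Lam : L → MvPolynomial (D ⊕ E) K := fun i => if i ∈ A then X (.inr (o i)) else 0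
  let F' : MvPolynomial σ (MvPolynomial (D ⊕ E) K) := polyOfCoeffs e fun d => X (.inl d)
  let G' : L → MvPolynomial σ (MvPolynomial (D ⊕ E) K) := fun i =>
    polyOfCoeffs f fun d => if p d = i then X (.inr d) else 0
  let q : D ⊕ E → MvPolynomial (D ⊕ E) K := Sum.elim
    (Function.extend s
      (fun k => Z k - eval Z (pderiv k F') + ∑ i, Lam i * eval Z (pderiv k (G' i)))
      (fun d => X (.inl d)))
    (fun d => if d = o (p d) ∧ p d ∈ A then X (.inr d) - eval Z (G' (p d)) else X (.inr d))
  obtain ⟨ρ, hρ, H⟩ := exists_ne_zero_finite_fiber q (Sum.elim Z Lam)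
  refine ⟨ρ, hρ, fun c hc => (H c hc).subset ?_⟩
  rintro v ⟨h1, h2, h3⟩
  let z : σ → K := fun k => v (.inl k)
  let t : D ⊕ E → K := Sum.elim (Function.extend s z (fun d => c (.inl d)))
    (fun d => if d = o (p d) ∧ p d ∈ A then v (.inr (p d)) else c (.inr d))
  have htZ : ∀ k, eval t (Z k) = z k := fun k => by
    simp [Z, t, hsinj.extend_apply]
  have htL : ∀ i, eval t (Lam i) = v (.inr i) := fun i => by
    by_cases hi : i ∈ A
    · simp [Lam, t, hi, hp]
    · simp [Lam, hi, h3 i hi]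
  have hF : map (eval t) F' = polyOfCoeffs e (fun d => c (.inl d)) +
      ∑ k, C (z k - c (.inl (s k))) * X k := by
    rw [← sub_eq_iff_eq_add', map_polyOfCoeffs, polyOfCoeffs_sub, polyOfCoeffs, eq_comm]
    refine Fintype.sum_of_injective s hsinj _ _ ?_ ?_
    · intro d hd
      have : t (.inl d) = c (.inl d) := by
        simp only [t, Sum.elim_inl]
        exact Function.extend_apply' _ _ _ (by simpa using hd)
      simp [this]
    · intro k
      have : t (.inl (s k)) = z k := by simp [t, hsinj.extend_apply]
      rw [eval_X, this, hs, C_mul_X_eq_monomial]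
  have hG : ∀ i, map (eval t) (G' i) =
      polyOfCoeffs f (fun d => if p d = i then c (.inr d) else 0) +
        C (if i ∈ A then v (.inr i) - c (.inr (o i)) else 0) := by
    intro i
    rw [← sub_eq_iff_eq_add', map_polyOfCoeffs, polyOfCoeffs_sub, polyOfCoeffs]
    rw [Finset.sum_eq_single (o i)]
    · by_cases hi : i ∈ A <;> simp [ho, hp, hi, t]
    · intro d _ hd
      by_cases hpd : p d = i
      · subst hpd
        simp [t, hd]
      · simp [hpd]
    · simp
  have hdF : ∀ k, pderiv k (map (eval t) F') =
      pderiv k (polyOfCoeffs e (fun d => c (.inl d))) + C (z k - c (.inl (s k))) := by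
    intro k
    simp [hF, pderiv_X, Pi.single_apply]
  refine ⟨t, ?_, ?_⟩
  · rintro (d | d)
    · by_cases hd : ∃ k, s k = d
      · obtain ⟨k, rfl⟩ := hd
        have hk := h1 k
        simp only [q, Sum.elim_inl, hsinj.extend_apply, map_add, map_sub, map_sum, map_mul,
          eval_eval_eq, ← pderiv_map, htZ, htL]
        simp only [hdF, hG, map_add, pderiv_C, add_zero, eval_C]
        rw [← hk]
        ring
      · simp only [q, Sum.elim_inl, Function.extend_apply' _ _ _ hd, eval_X, t]
    · by_cases hd : d = o (p d) ∧ p d ∈ A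
      · have hk := h2 _ hd.2
        have htd : t (.inr d) = v (.inr (p d)) := if_pos hd
        have hqd : q (.inr d) = X (.inr d) - eval Z (G' (p d)) := if_pos hd
        simp only [hqd, map_sub, eval_eval_eq, htZ, hG, map_add, eval_C, eval_X, htd,
          if_pos hd.2, ← hd.1, z, hk]
        ring
      · simp only [q, Sum.elim_inr, if_neg hd, eval_X, t]
  · rintro (k | i)
    · exact (htZ k).symm
    · exact (htL i).symm

/-- For generic coefficients, the critical-point system with complementarity conditions
`v_i G_i = 0` (and `G_i = 0` for `i ∈ S`) has finitely many solutions. -/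
theorem exists_ne_zero_finite_kkt {σ L D E K : Type} [Fintype σ] [Fintype L] [Fintype D]
    [Fintype E] [DecidableEq L] [Field K]
    (e : D → σ →₀ ℕ) (s : σ → D) (hs : ∀ k, e (s k) = Finsupp.single k 1)
    (f : E → σ →₀ ℕ) (p : E → L) (o : L → E) (ho : ∀ i, f (o i) = 0) (hp : ∀ i, p (o i) = i)
    (S : Finset L) :
    ∃ ρ : MvPolynomial (D ⊕ E) K, ρ ≠ 0 ∧ ∀ c : D ⊕ E → K, eval c ρ ≠ 0 →
      {v : σ ⊕ L → K |
        (∀ k, eval (fun k => v (.inl k)) (pderiv k (polyOfCoeffs e fun d => c (.inl d))) =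
          ∑ i, v (.inr i) * eval (fun k => v (.inl k))
            (pderiv k (polyOfCoeffs f fun d => if p d = i then c (.inr d) else 0))) ∧
        (∀ i ∈ S, eval (fun k => v (.inl k))
          (polyOfCoeffs f fun d => if p d = i then c (.inr d) else 0) = 0) ∧
        ∀ i ∉ S, v (.inr i) * eval (fun k => v (.inl k))
          (polyOfCoeffs f fun d => if p d = i then c (.inr d) else 0) = 0}.Finite := by
  classical
  choose ρ hρ H using fun A : Finset L =>
    exists_ne_zero_finite_critical (K := K) e s hs f p o ho hp A
  refine ⟨∏ A, ρ A, Finset.prod_ne_zero_iff.2 fun A _ => hρ A, fun c hc => ?_⟩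
  rw [map_prod, Finset.prod_ne_zero_iff] at hc
  refine (Set.finite_iUnion fun A => H A c (hc A (Finset.mem_univ _))).subset ?_
  rintro v ⟨h1, h2, h3⟩
  refine Set.mem_iUnion.2 ⟨Finset.univ.filter fun i => i ∈ S ∨ v (.inr i) ≠ 0, h1, ?_, ?_⟩
  · intro i hi
    by_cases hS : i ∈ S
    · exact h2 i hS
    · have hv : v (.inr i) ≠ 0 := by simpa [hS] using hi
      exact (mul_eq_zero.1 (h3 i hS)).resolve_left hv
  · intro i hi
    by_contra hv
    exact hi (by simp [hv])

theorem finite_XMon (n a : ℕ) : Finite (XMon n a) := by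
  refine Finite.of_injective
    (fun (d : XMon n a) (i : Fin n) =>
      (⟨d.1 i, Nat.lt_succ_of_le ((Finset.single_le_sum (fun _ _ => Nat.zero_le _)
        (Finset.mem_univ i)).trans d.2)⟩ : Fin (a + 1))) ?_
  intro d d' h
  ext i
  simpa using congrFun h i

theorem finite_XYMon (n m a b : ℕ) : Finite (XYMon n m a b) := by
  refine Finite.of_injective
    (fun (d : XYMon n m a b) (k : Fin n ⊕ Fin m) =>
      (⟨d.1 k, ?_⟩ : Fin (a + b + 1))) ?_
  · have h1 := d.2.1
    have h2 := d.2.2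
    rcases k with i | j
    · have := Finset.single_le_sum (f := fun i => d.1 (Sum.inl i)) (fun _ _ => Nat.zero_le _)
        (Finset.mem_univ i)
      omega
    · have := Finset.single_le_sum (f := fun j => d.1 (Sum.inr j)) (fun _ _ => Nat.zero_le _)
        (Finset.mem_univ j)
      omega
  · intro d d' h
    ext i
    simpa using congrFun h i

theorem pderiv_rename_of_notMem_range {σ τ R : Type} [CommSemiring R] (u : σ → τ) {k : τ}
    (hk : k ∉ Set.range u) (P : MvPolynomial σ R) : pderiv k (rename u P) = 0 := by
  classical
  refine pderiv_eq_zero_of_notMem_vars fun h => hk ?_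
  obtain ⟨i, -, rfl⟩ := Finset.mem_image.1 (vars_rename u P h)
  exact ⟨i, rfl⟩

theorem polyOfCoeffs_coeff_of_totalDegree_le {n a : ℕ} [Fintype (XMon n a)]
    (P : MvPolynomial (Fin n) ℂ) (hP : P.totalDegree ≤ a) :
    polyOfCoeffs (fun d : XMon n a => d.1) (fun d => P.coeff d.1) = P := by
  refine polyOfCoeffs_coeff _ Subtype.val_injective P fun d hd => ⟨⟨d, ?_⟩, rfl⟩
  have := (le_totalDegree hd).trans hP
  rwa [Finsupp.sum_fintype _ _ fun _ => rfl] at this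

/-- For generic polynomials `F, g, h` with the given degree bounds, the critical-point
system (3.3) has only finitely many complex solutions `(x, y, λ, μ)`; equivalently,
only finitely many points `(x, y)` admit such multipliers. -/
theorem stmt3 (n m l1 l2 : ℕ) (a0 b0 : ℕ) (aa : Fin l1 → ℕ) (bb : Fin l2 → ℕ)
    (ha0 : 0 < a0) (hb0 : 0 < b0) (haa : ∀ i, 0 < aa i) (hbb : ∀ j, 0 < bb j)
    (E1X E2X : Finset (Fin l1)) (hXu : E1X ∪ E2X = Finset.univ) (hXd : Disjoint E1X E2X)
    (E1Y E2Y : Finset (Fin l2)) (hYu : E1Y ∪ E2Y = Finset.univ) (hYd : Disjoint E1Y E2Y) :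
    ∃ ρ : MvPolynomial
        (XYMon n m a0 b0 ⊕ (((i : Fin l1) × XMon n (aa i)) ⊕ ((j : Fin l2) × XMon m (bb j)))) ℂ,
      ρ ≠ 0 ∧
      ∀ (F : MvPolynomial (Fin n ⊕ Fin m) ℂ)
        (g : Fin l1 → MvPolynomial (Fin n) ℂ) (h : Fin l2 → MvPolynomial (Fin m) ℂ),
        (∀ d ∈ F.support, (∑ i, d (Sum.inl i)) ≤ a0 ∧ (∑ j, d (Sum.inr j)) ≤ b0) →
        (∀ i, (g i).totalDegree ≤ aa i) → (∀ j, (h j).totalDegree ≤ bb j) →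
        eval (fun idx =>
          match idx with
          | Sum.inl d => F.coeff d.1
          | Sum.inr (Sum.inl ⟨i, d⟩) => (g i).coeff d.1
          | Sum.inr (Sum.inr ⟨j, d⟩) => (h j).coeff d.1) ρ ≠ 0 →
        ({p : (Fin n → ℂ) × (Fin m → ℂ) × (Fin l1 → ℂ) × (Fin l2 → ℂ) |
            SadSys E1X E2X E1Y E2Y F g h p.1 p.2.1 p.2.2.1 p.2.2.2}.Finite ∧
         {q : (Fin n → ℂ) × (Fin m → ℂ) |
            ∃ lam mu, SadSys E1X E2X E1Y E2Y F g h q.1 q.2 lam mu}.Finite) := by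
  classical
  have := fun i => finite_XMon n (aa i)
  have := fun j => finite_XMon m (bb j)
  have := finite_XYMon n m a0 b0
  have := fun i => Fintype.ofFinite (XMon n (aa i))
  have := fun j => Fintype.ofFinite (XMon m (bb j))
  have := Fintype.ofFinite (XYMon n m a0 b0)
  let s : Fin n ⊕ Fin m → XYMon n m a0 b0 := fun k => ⟨Finsupp.single k 1, by
    rcases k with k | k
    · simp [Finsupp.single_apply]; omega
    · simp [Finsupp.single_apply]; omega⟩
  let f : ((i : Fin l1) × XMon n (aa i)) ⊕ ((j : Fin l2) × XMon m (bb j)) →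
      (Fin n ⊕ Fin m) →₀ ℕ :=
    Sum.elim (fun d => d.2.1.mapDomain Sum.inl) (fun d => d.2.1.mapDomain Sum.inr)
  let o : Fin l1 ⊕ Fin l2 →
      ((i : Fin l1) × XMon n (aa i)) ⊕ ((j : Fin l2) × XMon m (bb j)) :=
    Sum.map (fun i => ⟨i, 0, by simp⟩) (fun j => ⟨j, 0, by simp⟩)
  obtain ⟨ρ, hρ, H⟩ := exists_ne_zero_finite_kkt (K := ℂ) (fun d : XYMon n m a0 b0 => d.1) s
    (fun _ => rfl) f (Sum.map Sigma.fst Sigma.fst) o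
    (by rintro (i | j) <;> simp [f, o]) (by rintro (i | j) <;> rfl) (E1X.disjSum E1Y)
  refine ⟨ρ, hρ, fun F g h hF hg hh hc => ?_⟩
  have hfin := H _ hc
  have hFc : polyOfCoeffs (fun d : XYMon n m a0 b0 => d.1) (fun d => F.coeff d.1) = F :=
    polyOfCoeffs_coeff _ Subtype.val_injective F fun d hd => ⟨⟨d, hF d hd⟩, rfl⟩
  have key : {p : (Fin n → ℂ) × (Fin m → ℂ) × (Fin l1 → ℂ) × (Fin l2 → ℂ) |
      SadSys E1X E2X E1Y E2Y F g h p.1 p.2.1 p.2.2.1 p.2.2.2}.Finite := by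
    have hinj : Function.Injective
        (fun p : (Fin n → ℂ) × (Fin m → ℂ) × (Fin l1 → ℂ) × (Fin l2 → ℂ) =>
          (Sum.elim (Sum.elim p.1 p.2.1) (Sum.elim p.2.2.1 p.2.2.2) :
            (Fin n ⊕ Fin m) ⊕ (Fin l1 ⊕ Fin l2) → ℂ)) := by
      rintro ⟨x, y, lam, mu⟩ ⟨x', y', lam', mu'⟩ hpq
      simpa [Sum.elim_eq_iff, and_assoc] using hpq
    refine (hfin.preimage hinj.injOn).subset ?_
    rintro ⟨x, y, lam, mu⟩ ⟨h1, h2, h3, h4, h5, h6⟩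
    have hGX : ∀ i, (polyOfCoeffs f fun d => if Sum.map Sigma.fst Sigma.fst d = Sum.inl i then
        (Sum.elim (fun d => (g d.1).coeff d.2.1) (fun d => (h d.1).coeff d.2.1) d : ℂ) else 0) =
        rename Sum.inl (g i) := by
      intro i
      conv_rhs => rw [← polyOfCoeffs_coeff_of_totalDegree_le (g i) (hg i)]
      simp only [polyOfCoeffs, Fintype.sum_sum_type, Fintype.sum_sigma, map_sum,
        rename_monomial, f]
      rw [Fintype.sum_eq_single i (by intro i' hi'; simp [hi'])]
      simp
    have hGY : ∀ j, (polyOfCoeffs f fun d => if Sum.map Sigma.fst Sigma.fst d = Sum.inr j then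
        (Sum.elim (fun d => (g d.1).coeff d.2.1) (fun d => (h d.1).coeff d.2.1) d : ℂ) else 0) =
        rename Sum.inr (h j) := by
      intro j
      conv_rhs => rw [← polyOfCoeffs_coeff_of_totalDegree_le (h j) (hh j)]
      simp only [polyOfCoeffs, Fintype.sum_sum_type, Fintype.sum_sigma, map_sum,
        rename_monomial, f]
      rw [Fintype.sum_eq_single j (by intro j' hj'; simp [hj'])]
      simp
    have hcoeff : ∀ d : ((i : Fin l1) × XMon n (aa i)) ⊕ ((j : Fin l2) × XMon m (bb j)),
        (match (motive := XYMon n m a0 b0 ⊕ (((i : Fin l1) × XMon n (aa i)) ⊕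
            ((j : Fin l2) × XMon m (bb j))) → ℂ) Sum.inr d with
          | Sum.inl d => F.coeff d.1
          | Sum.inr (Sum.inl ⟨i, d⟩) => (g i).coeff d.1
          | Sum.inr (Sum.inr ⟨j, d⟩) => (h j).coeff d.1) =
        Sum.elim (fun d => (g d.1).coeff d.2.1) (fun d => (h d.1).coeff d.2.1) d := by
      rintro (d | d) <;> rfl
    simp only [Set.mem_preimage, Set.mem_ofPred_eq, hcoeff, hFc, Sum.elim_inr,
      Fintype.sum_sum_type, Sum.elim_inl, Sum.forall, hGX, hGY, Finset.inl_mem_disjSum,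
      Finset.inr_mem_disjSum, eval_rename, Sum.elim_comp_inl, Sum.elim_comp_inr,
      pderiv_rename Sum.inl_injective, pderiv_rename Sum.inr_injective]
    have hlr : ∀ (j : Fin n) (P : MvPolynomial (Fin m) ℂ),
        pderiv (Sum.inl j) (rename (Sum.inr : Fin m → Fin n ⊕ Fin m) P) = 0 := fun j P =>
      pderiv_rename_of_notMem_range _ (by simp) P
    have hrl : ∀ (j : Fin m) (P : MvPolynomial (Fin n) ℂ),
        pderiv (Sum.inr j) (rename (Sum.inl : Fin n → Fin n ⊕ Fin m) P) = 0 := fun j P =>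
      pderiv_rename_of_notMem_range _ (by simp) P
    simp only [hlr, hrl, map_zero, mul_zero, Finset.sum_const_zero, add_zero, zero_add]
    refine ⟨⟨h1, h2⟩, ⟨h3, h5⟩, fun i hi => h4 i ?_, fun j hj => h6 j ?_⟩
    · exact (Finset.mem_union.1 (hXu ▸ Finset.mem_univ i)).resolve_left hi
    · exact (Finset.mem_union.1 (hYu ▸ Finset.mem_univ j)).resolve_left hj
  refine ⟨key, (key.image fun p => (p.1, p.2.1)).subset ?_⟩
  rintro ⟨x, y⟩ ⟨lam, mu, hs⟩
  exact ⟨(x, y, lam, mu), hs, rfl⟩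
end

section
/- Fix positive integers a_0, b_0, positive degrees a_i (i = 1, ..., l1) and b_j (j = 1, ..., l2), and index-set partitions E1X, E2X of {1,...,l1} and E1Y, E2Y of {1,...,l2}. Define M := Σ a_{i_1}···a_{i_{r1}} b_{j_1}···b_{j_{r2}} · s, where the outer sum is over all subsets {i_1,...,i_{r1}} ⊆ {1,...,l1} with 0 ≤ r1 ≤ n and all subsets {j_1,...,j_{r2}} ⊆ {1,...,l2} with 0 ≤ r2 ≤ m, and where s := Σ (a_0+b_0)^{k_0} (a_{i_1})^{k_1}···(a_{i_{r1}})^{k_{r1}} (b_{j_1})^{k_{r1+1}}···(b_{j_{r2}})^{k_{r1+r2}}, the inner sum being over all tuples of nonnegative integers k_0, ..., k_{r1+r2} with k_0 + ··· + k_{r1+r2} = n + m − r1 − r2. Then there exists a nonzero polynomial ρ on the coefficient space of tuples (F, g, h) (with F ∈ ℂ[x,y] of degree at most a_0 in x and b_0 in y, g_i ∈ ℂ[x] of degree ≤ a_i, h_j ∈ ℂ[y] of degree ≤ b_j) such that whenever ρ does not vanish at (F, g, h), the set of points (x,y) ∈ ℂ^n × ℂ^m for which there exist λ ∈ ℂ^{l1},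 μ ∈ ℂ^{l2} with ∇_x F(x,y) = Σ_i λ_i ∇g_i(x), ∇_y F(x,y) = Σ_j μ_j ∇h_j(y), g_i(x) = 0 (i ∈ E1X), λ_i g_i(x) = 0 (i ∈ E2X), h_j(y) = 0 (j ∈ E1Y), μ_j h_j(y) = 0 (j ∈ E2Y), has cardinality at most M. -/
open MvPolynomial

/-- The inner sum `s = Σ_{k₀+⋯+k_r = d} vals₀^{k₀} ⋯ vals_r^{k_r}`, over all tuples of
nonnegative integers summing to `d`, where `vals` is the list of base values. -/
noncomputable def innerS (vals : List ℕ) (d : ℕ) : ℕ :=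
  ∑ k ∈ (Fintype.piFinset fun _ : Fin vals.length => Finset.range (d + 1)).filter
      (fun k => ∑ i, k i = d),
    ∏ i, vals.get i ^ k i

/-- The upper bound `M` of (3.4): the sum over all subsets
`{i₁,...,i_{r₁}} ⊆ [l₁]` with `r₁ ≤ n` and `{j₁,...,j_{r₂}} ⊆ [l₂]` with `r₂ ≤ m` of
`a_{i₁}⋯a_{i_{r₁}} b_{j₁}⋯b_{j_{r₂}} · s`, where `s` is the sum over all
`k₀+⋯+k_{r₁+r₂} = n+m−r₁−r₂` of `(a₀+b₀)^{k₀} a_{i₁}^{k₁}⋯ b_{j_{r₂}}^{k_{r₁+r₂}}`. -/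
noncomputable def boundM (n m l1 l2 : ℕ) (a0 b0 : ℕ) (aa : Fin l1 → ℕ) (bb : Fin l2 → ℕ) : ℕ :=
  ∑ S ∈ (Finset.univ : Finset (Finset (Fin l1))).filter (fun S => S.card ≤ n),
    ∑ T ∈ (Finset.univ : Finset (Finset (Fin l2))).filter (fun T => T.card ≤ m),
      (∏ i ∈ S, aa i) * (∏ j ∈ T, bb j) *
        innerS ((a0 + b0) :: (S.toList.map aa ++ T.toList.map bb))
          (n + m - S.card - T.card)

theorem multichoose_add (m n k : ℕ) :
    Nat.multichoose (m + n) k =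
      ∑ p ∈ Finset.HasAntidiagonal.antidiagonal k,
        Nat.multichoose m p.1 * Nat.multichoose n p.2 := by
  induction m generalizing k with
  | zero =>
    rw [Finset.sum_eq_single (0, k)]
    · simp
    · rintro ⟨i, j⟩ h h'
      cases i with
      | zero => simp_all
      | succ i => simp
    · simp
  | succ m ih =>
    induction k with
    | zero => simp
    | succ k ihk =>
      rw [show m + 1 + n = (m + n) + 1 by ring, Nat.multichoose_succ_succ, ih,
        show m + n + 1 = m + 1 + n by ring, ihk, Finset.Nat.sum_antidiagonal_succ,
        Finset.Nat.sum_antidiagonal_succ]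
      simp only [Nat.multichoose_succ_succ, add_mul, Finset.sum_add_distrib,
        Nat.multichoose_zero_right]
      ring

theorem multichoose_sum {J : Type*} [DecidableEq J] (s : Finset J) (c : J → ℕ) (k : ℕ) :
    Nat.multichoose (∑ j ∈ s, c j) k =
      ∑ κ ∈ s.finsuppAntidiag k, ∏ j ∈ s, Nat.multichoose (c j) (κ j) := by
  have h : PowerSeries.mk (fun k => Nat.multichoose (∑ j ∈ s, c j) k) =
      ∏ j ∈ s, PowerSeries.mk (fun k => Nat.multichoose (c j) k) := by
    induction s using Finset.induction_on with
    | empty =>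
      ext k
      cases k <;> simp [PowerSeries.coeff_one]
    | insert a s ha ih =>
      rw [Finset.sum_insert ha, Finset.prod_insert ha, ← ih]
      ext k
      simp [PowerSeries.coeff_mul, multichoose_add]
  have := congrArg (PowerSeries.coeff k) h
  simpa [PowerSeries.coeff_prod] using this

theorem multichoose_mul_le (b A i : ℕ) :
    Nat.multichoose (b * A) i ≤ A ^ i * Nat.multichoose (i + 1) b := by
  rcases Nat.eq_zero_or_pos A with rfl | hA
  · cases i <;> simp
  have h1 : (b * A).ascFactorial i ≤ A ^ i * (b + 1).ascFactorial i := by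
    induction i with
    | zero => simp
    | succ i ih =>
      rw [Nat.ascFactorial_succ, Nat.ascFactorial_succ, pow_succ]
      calc (b * A + i) * (b * A).ascFactorial i
          ≤ (A * (b + 1 + i)) * (A ^ i * (b + 1).ascFactorial i) := by
            gcongr
            nlinarith
        _ = _ := by ring
  rw [Nat.ascFactorial_eq_factorial_mul_choose', Nat.ascFactorial_eq_factorial_mul_choose'] at h1
  have h2 : Nat.multichoose (i + 1) b = (b + 1 + i - 1).choose i := by
    rw [Nat.multichoose_eq, show i + 1 + b - 1 = b + i by omega,
      show b + 1 + i - 1 = b + i by omega, Nat.choose_symm_add]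
  rw [h2, Nat.multichoose_eq]
  refine Nat.le_of_mul_le_mul_left ?_ (Nat.factorial_pos i)
  linarith

/-- The complete homogeneous symmetric polynomial of degree `k`, evaluated at `A`. -/
noncomputable def completeHom {J : Type*} [Fintype J] (A : J → ℕ) (k : ℕ) : ℕ :=
  PowerSeries.coeff k (∏ j, PowerSeries.mk fun i => A j ^ i)

theorem completeHom_eq {J : Type*} [Fintype J] [DecidableEq J] (A : J → ℕ) (k : ℕ) :
    completeHom A k = ∑ κ ∈ Finset.univ.finsuppAntidiag k, ∏ j, A j ^ κ j := by
  simp [completeHom, PowerSeries.coeff_prod]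

theorem innerS_eq_coeff (vals : List ℕ) (k : ℕ) :
    innerS vals k =
      PowerSeries.coeff k (vals.map fun A => PowerSeries.mk fun i => A ^ i).prod := by
  have h : (vals.map fun A => PowerSeries.mk fun i => A ^ i).prod =
      ∏ j : Fin vals.length, PowerSeries.mk fun i => vals.get j ^ i := by
    rw [← List.prod_ofFn]
    congr 1
    conv_lhs => rw [← List.ofFn_get vals]
    rw [List.map_ofFn]
    rfl
  rw [h]
  change _ = completeHom _ _
  rw [completeHom_eq, innerS]
  refine Finset.sum_bij' (fun κ _ => Finsupp.equivFunOnFinite.symm κ) (fun κ _ => ⇑κ) ?_ ?_ ?_ ?_ ?_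
  · intro κ hκ
    simp at hκ ⊢
    exact hκ.2
  · intro κ hκ
    simp at hκ ⊢
    refine ⟨fun a => ?_, hκ⟩
    rw [← hκ]
    exact (Finset.single_le_sum (fun _ _ => Nat.zero_le _) (Finset.mem_univ a))
  · intros; rfl
  · intros; ext; rfl
  · intros; rfl

theorem sum_multichoose_le {J : Type*} [Fintype J] [DecidableEq J] (A : J → ℕ) (t k : ℕ) :
    ∑ β ∈ Finset.univ.finsuppAntidiag t, Nat.multichoose (∑ j, β j * A j) k ≤
      completeHom A k * Nat.multichoose (k + Fintype.card J) t := by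
  simp_rw [multichoose_sum]
  rw [Finset.sum_comm, completeHom_eq, Finset.sum_mul]
  refine Finset.sum_le_sum fun κ hκ => ?_
  have hk : k + Fintype.card J = ∑ j, (κ j + 1) := by
    simp at hκ
    simp [Finset.sum_add_distrib, hκ]
  rw [hk, multichoose_sum, Finset.mul_sum]
  refine Finset.sum_le_sum fun β _ => ?_
  rw [← Finset.prod_mul_distrib]
  exact Finset.prod_le_prod' fun j _ => multichoose_mul_le _ _ _

theorem degree_le_of_coeff_ne_zero {Z R : Type*} [CommSemiring R] {p : MvPolynomial Z R}
    {α : Z →₀ ℕ} (h : p.coeff α ≠ 0) : α.degree ≤ p.totalDegree :=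
  le_totalDegree (mem_support_iff.mpr h)

theorem coeff_eq_zero_of_lt_degree {Z R : Type*} [CommSemiring R] {p : MvPolynomial Z R}
    {α : Z →₀ ℕ} (h : p.totalDegree < α.degree) : p.coeff α = 0 := by
  by_contra h'
  exact absurd (degree_le_of_coeff_ne_zero h') (not_le.mpr h)

theorem totalDegree_pderiv_succ_le {Z R : Type*} [CommSemiring R] {p : MvPolynomial Z R}
    {q : ℕ} (hq : 0 < q) (hp : p.totalDegree ≤ q) (z : Z) :
    (pderiv z p).totalDegree + 1 ≤ q := by
  suffices h : (pderiv z p).totalDegree ≤ q - 1 by omega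
  rw [p.as_sum, map_sum]
  refine totalDegree_finsetSum_le fun α hα => ?_
  rw [pderiv_monomial]
  by_cases h0 : α z = 0
  · simp [h0]
  · have h1 := degree_le_of_coeff_ne_zero (mem_support_iff.mp hα)
    have h2 : Finsupp.single z 1 ≤ α := by
      rw [Finsupp.single_le_iff]
      omega
    have h3 : (α - Finsupp.single z 1).degree + 1 = α.degree := by
      conv_rhs => rw [← tsub_add_cancel_of_le h2]
      simp
    refine (totalDegree_monomial_le _ _).trans ?_
    change (α - Finsupp.single z 1).degree ≤ _
    omega

/-- If a family of polynomials of degree at most `q` specialises to the monomials of degree at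
most `q`, then a multiple of each such monomial is a combination of the family. -/
theorem exists_smul_monomial_mem_span {Z Λ k : Type*} [Finite Z] [CommRing Λ] [CommRing k]
    (σ : Λ →+* k) (q : ℕ) (f : (Z →₀ ℕ) → MvPolynomial Z Λ)
    (hdeg : ∀ α, α.degree ≤ q → (f α).totalDegree ≤ q)
    (hσ : ∀ α, α.degree ≤ q → map σ (f α) = monomial α 1) :
    ∃ d : Λ, σ d = 1 ∧ ∀ α, α.degree ≤ q →
      d • monomial α (1 : Λ) ∈ Submodule.span Λ (f '' {β | β.degree ≤ q}) := by
  classical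
  have : Fintype {α : Z →₀ ℕ // α.degree ≤ q} := (Finsupp.finite_of_degree_le (σ := Z) q).fintype
  let M : Matrix {α : Z →₀ ℕ // α.degree ≤ q} {α : Z →₀ ℕ // α.degree ≤ q} Λ :=
    Matrix.of fun α β => coeff β.1 (f α.1)
  have hf : ∀ β : {α : Z →₀ ℕ // α.degree ≤ q}, f β.1 = ∑ γ, M β γ • monomial γ.1 (1 : Λ) := by
    intro β
    ext δ
    simp only [coeff_sum, coeff_smul, coeff_monomial, smul_eq_mul, mul_ite, mul_one, mul_zero]
    by_cases hδ : δ.degree ≤ q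
    · rw [Finset.sum_eq_single ⟨δ, hδ⟩]
      · simp [M]
      · intro γ _ hγ
        rw [if_neg]
        rintro rfl
        exact hγ rfl
      · simp
    · rw [Finset.sum_eq_zero]
      · exact coeff_eq_zero_of_lt_degree ((hdeg _ β.2).trans_lt (not_le.mp hδ))
      · intro γ _
        rw [if_neg]
        rintro rfl
        exact hδ γ.2
  refine ⟨M.det, ?_, fun α hα => ?_⟩
  · rw [RingHom.map_det]
    suffices h : σ.mapMatrix M = 1 by rw [h, Matrix.det_one]
    ext α β
    have := congrArg (coeff β.1) (hσ α.1 α.2)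
    rw [coeff_map, coeff_monomial] at this
    simp only [RingHom.mapMatrix_apply, Matrix.map_apply, M, Matrix.of_apply, this,
      Matrix.one_apply, Subtype.ext_iff]
  · have h : M.det • monomial α (1 : Λ) = ∑ β, M.adjugate ⟨α, hα⟩ β • f β.1 := by
      simp_rw [hf, Finset.smul_sum, smul_smul]
      rw [Finset.sum_comm]
      simp_rw [← Finset.sum_smul, ← Matrix.mul_apply, Matrix.adjugate_mul]
      rw [Finset.sum_eq_single ⟨α, hα⟩]
      · simp
      · intro γ _ hγ
        simp [hγ.symm]
      · simp
    rw [h]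
    exact Submodule.sum_mem _ fun β _ =>
      Submodule.smul_mem _ _ (Submodule.subset_span ⟨β.1, β.2, rfl⟩)

theorem totalDegree_monomial_mul_le {Z Λ : Type*} [CommRing Λ] (z : Z) (α : Z →₀ ℕ) (a : ℕ)
    (p : MvPolynomial Z Λ) (hp : p.totalDegree ≤ a) (h : a ≤ α z) :
    (monomial (α - Finsupp.single z a) 1 * p).totalDegree ≤ α.degree := by
  have h2 : Finsupp.single z a ≤ α := by rwa [Finsupp.single_le_iff]
  have h3 : (α - Finsupp.single z a).degree + a = α.degree := by
    conv_rhs => rw [← tsub_add_cancel_of_le h2]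
    simp
  have h4 : (monomial (α - Finsupp.single z a) (1 : Λ)).totalDegree ≤
      (α - Finsupp.single z a).degree := totalDegree_monomial_le _ _
  have := totalDegree_mul (monomial (α - Finsupp.single z a) (1 : Λ)) p
  omega

theorem map_monomial_mul_eq {Z Λ k : Type*} [CommRing Λ] [CommRing k] (σ : Λ →+* k) (z : Z)
    (α : Z →₀ ℕ) (a : ℕ) (p : MvPolynomial Z Λ) (hp : map σ p = X z ^ a) (h : a ≤ α z) :
    map σ (monomial (α - Finsupp.single z a) 1 * p) = monomial α 1 := by
  have h2 : Finsupp.single z a ≤ α := by rwa [Finsupp.single_le_iff]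
  rw [map_mul, hp, map_monomial, X_pow_eq_monomial, monomial_mul, tsub_add_cancel_of_le h2]
  simp

/-- Modulo polynomials specialising to pure powers of distinct variables, a multiple of every
monomial is a combination of monomials of smaller degree in the remaining box. -/
theorem exists_smul_mem_span_box {Z E Λ k 𝓕 : Type*} [Finite Z] [CommRing Λ] [CommRing k]
    [CommRing 𝓕] [Algebra Λ 𝓕] (σ : Λ →+* k) (x : Z → 𝓕) (g : E → MvPolynomial Z Λ)
    (hg : ∀ e, aeval x (g e) = 0) (a : E → ℕ) (ι : E → Z) (hdeg : ∀ e, (g e).totalDegree ≤ a e)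
    (hσ : ∀ e, map σ (g e) = X (ι e) ^ a e) (q : ℕ) :
    ∃ d : Λ, σ d = 1 ∧ ∀ α : Z →₀ ℕ, α.degree ≤ q →
      d • aeval x (monomial α (1 : Λ)) ∈ Submodule.span Λ
        {v | ∃ β : Z →₀ ℕ, β.degree ≤ q ∧ (∀ e, β (ι e) < a e) ∧
          v = aeval x (monomial β (1 : Λ))} := by
  classical
  let f : (Z →₀ ℕ) → MvPolynomial Z Λ := fun α =>
    if h : ∃ e, a e ≤ α (ι e) then
      monomial (α - Finsupp.single (ι h.choose) (a h.choose)) 1 * g h.choose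
    else monomial α 1
  have hf₁ : ∀ α, α.degree ≤ q → (f α).totalDegree ≤ q := by
    intro α hα
    by_cases h2 : ∃ e, a e ≤ α (ι e)
    · simp only [f, h2, dite_true]
      exact (totalDegree_monomial_mul_le _ _ _ _ (hdeg _) h2.choose_spec).trans hα
    · simp only [f, h2, dite_false]
      exact (totalDegree_monomial_le _ _).trans hα
  have hf₂ : ∀ α, α.degree ≤ q → map σ (f α) = monomial α 1 := by
    intro α hα
    by_cases h2 : ∃ e, a e ≤ α (ι e)
    · simp only [f, h2, dite_true]
      exact map_monomial_mul_eq σ _ _ _ _ (hσ _) h2.choose_spec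
    · simp [f, h2]
  obtain ⟨d, hd, h⟩ := exists_smul_monomial_mem_span σ q f hf₁ hf₂
  refine ⟨d, hd, fun α hα => ?_⟩
  have h1 := Submodule.mem_map_of_mem (f := (aeval x : MvPolynomial Z Λ →ₐ[Λ] 𝓕).toLinearMap)
    (h α hα)
  rw [Submodule.map_span] at h1
  simp only [map_smul, AlgHom.toLinearMap_apply] at h1
  refine Submodule.span_le.mpr ?_ h1
  rintro _ ⟨_, ⟨β, hβ, rfl⟩, rfl⟩
  by_cases h2 : ∃ e, a e ≤ β (ι e)
  · simp [f, h2, hg]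
  · have h3 : f β = monomial β 1 := dif_neg h2
    push Not at h2
    exact Submodule.subset_span ⟨β, hβ, h2, by rw [AlgHom.toLinearMap_apply, h3]⟩

/-- If a family of polynomials specialises to pure powers of all the variables together with `1`,
then it generates an ideal containing a constant that specialises to `1`. -/
theorem exists_C_mem_span {Z E Λ k : Type*} [Finite Z] [CommRing Λ] [CommRing k]
    (σ : Λ →+* k) (g : E → MvPolynomial Z Λ) (a : E → ℕ) (hdeg : ∀ e, (g e).totalDegree ≤ a e)
    (ε : Z → E) (hε : ∀ z, map σ (g (ε z)) = X z ^ a (ε z)) (e₀ : E) (he₀ : map σ (g e₀) = 1) :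
    ∃ d : Λ, σ d = 1 ∧ C d ∈ Ideal.span (Set.range g) := by
  classical
  have := Fintype.ofFinite Z
  let q := ∑ z, a (ε z) + a e₀
  let f : (Z →₀ ℕ) → MvPolynomial Z Λ := fun α =>
    if h : ∃ z, a (ε z) ≤ α z then
      monomial (α - Finsupp.single h.choose (a (ε h.choose))) 1 * g (ε h.choose)
    else monomial α 1 * g e₀
  have hf₁ : ∀ α, α.degree ≤ q → (f α).totalDegree ≤ q := by
    intro α hα
    by_cases h2 : ∃ z, a (ε z) ≤ α z
    · simp only [f, h2, dite_true]
      exact (totalDegree_monomial_mul_le _ _ _ _ (hdeg _) h2.choose_spec).trans hα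
    · simp only [f, h2, dite_false]
      push Not at h2
      have h3 : α.degree ≤ ∑ z, a (ε z) := by
        rw [Finsupp.degree_eq_sum]
        exact Finset.sum_le_sum fun z _ => (h2 z).le
      have h4 : (monomial α (1 : Λ)).totalDegree ≤ α.degree := totalDegree_monomial_le _ _
      have := totalDegree_mul (monomial α (1 : Λ)) (g e₀)
      have := hdeg e₀
      simp only [q]
      omega
  have hf₂ : ∀ α, α.degree ≤ q → map σ (f α) = monomial α 1 := by
    intro α hα
    by_cases h2 : ∃ z, a (ε z) ≤ α z
    · simp only [f, h2, dite_true]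
      exact map_monomial_mul_eq σ _ _ _ _ (hε _) h2.choose_spec
    · simp [f, h2, he₀]
  obtain ⟨d, hd, h⟩ := exists_smul_monomial_mem_span σ q f hf₁ hf₂
  refine ⟨d, hd, ?_⟩
  have h0 := h 0 (by simp)
  have h1 : (Submodule.span Λ (f '' {β | β.degree ≤ q})) ≤
      (Ideal.span (Set.range g)).restrictScalars Λ := by
    rw [Submodule.span_le]
    rintro _ ⟨β, _, rfl⟩
    have h3 : ∀ (e : E) (p : MvPolynomial Z Λ), p * g e ∈ Ideal.span (Set.range g) :=
      fun e p => Ideal.mul_mem_left _ _ (Ideal.subset_span ⟨e, rfl⟩)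
    by_cases h2 : ∃ z, a (ε z) ≤ β z
    · simp only [f, h2, dite_true]
      exact h3 _ _
    · simp only [f, h2, dite_false]
      exact h3 _ _
  have h2 : d • monomial (0 : Z →₀ ℕ) (1 : Λ) = C d := by
    rw [smul_monomial, smul_eq_mul, mul_one]
    rfl
  rw [← h2]
  exact h1 h0

/-- The exponents of total degree at most `T`. -/
noncomputable def degreeLE (Y : Type*) [Fintype Y] (T : ℕ) : Finset (Y →₀ ℕ) :=
  (Finsupp.finite_of_degree_le (σ := Y) T).toFinset

theorem mem_degreeLE {Y : Type*} [Fintype Y] {T : ℕ} {γ : Y →₀ ℕ} :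
    γ ∈ degreeLE Y T ↔ γ.degree ≤ T := by
  simp [degreeLE]

theorem card_degreeLE (Y : Type*) [Fintype Y] (T : ℕ) :
    (degreeLE Y T).card = (T + Fintype.card Y).choose (Fintype.card Y) := by
  classical
  have h : degreeLE Y T =
      (Finset.range (T + 1)).biUnion fun i => Finset.univ.finsuppAntidiag i := by
    ext γ
    simp [mem_degreeLE, Finsupp.degree_eq_sum]
  rw [h, Finset.card_biUnion, ← Nat.sum_range_multichoose]
  · simp [Finset.card_finsuppAntidiag_nat_eq_multichoose]
  · intro i _ j _ hij
    rw [Function.onFun, Finset.disjoint_left]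
    intro γ h1 h2
    simp at h1 h2
    exact hij (h1.symm.trans h2)

/-- The exponents of total degree less than `Q` lying in the box `α (ι e) < a e`. -/
noncomputable def boxExponents {Z E : Type*} [Fintype Z] (ι : E → Z) (a : E → ℕ) (Q : ℕ) :
    Finset (Z →₀ ℕ) :=
  (Set.Finite.subset (Finsupp.finite_of_degree_le (σ := Z) Q)
    fun (α : Z →₀ ℕ) (h : α ∈ {α : Z →₀ ℕ | (∀ e, α (ι e) < a e) ∧ α.degree < Q}) =>
      h.2.le).toFinset

theorem mem_boxExponents {Z E : Type*} [Fintype Z] {ι : E → Z} {a : E → ℕ} {Q : ℕ}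
    {α : Z →₀ ℕ} : α ∈ boxExponents ι a Q ↔ (∀ e, α (ι e) < a e) ∧ α.degree < Q := by
  simp [boxExponents]

theorem card_boxExponents_le {Z E : Type*} [Fintype Z] [Fintype E] (ι : E → Z)
    (hι : Function.Injective ι) (a : E → ℕ) (Q : ℕ) :
    (boxExponents ι a Q).card ≤
      (∏ e, a e) * Nat.multichoose Q (Fintype.card Z - Fintype.card E) := by
  classical
  rcases Nat.eq_zero_or_pos Q with rfl | hQ
  · have : boxExponents ι a 0 = ∅ := by
      ext α
      simp [mem_boxExponents]
    simp [this]
  have hY : Fintype.card {z // ¬ z ∈ Set.range ι} = Fintype.card Z - Fintype.card E := by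
    rw [Fintype.card_subtype_compl, Fintype.card_congr (Equiv.ofInjective ι hι)]
  have h1 : (boxExponents ι a Q).card ≤ ((Fintype.piFinset fun e => Finset.range (a e)) ×ˢ
      degreeLE {z // ¬ z ∈ Set.range ι} (Q - 1)).card := by
    refine Finset.card_le_card_of_injOn
      (fun α => (fun e => α (ι e), α.subtypeDomain fun z => ¬ z ∈ Set.range ι)) ?_ ?_
    · intro α hα
      rw [Finset.mem_coe, mem_boxExponents] at hα
      rw [Finset.mem_coe, Finset.mem_product, Fintype.mem_piFinset, mem_degreeLE]
      refine ⟨fun e => Finset.mem_range.mpr (hα.1 e), ?_⟩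
      have h2 : (α.subtypeDomain fun z => ¬ z ∈ Set.range ι).degree ≤ α.degree := by
        rw [Finsupp.degree_eq_sum, Finsupp.degree_eq_sum,
          ← Fintype.sum_subtype_add_sum_subtype (fun z => ¬ z ∈ Set.range ι) α]
        exact Nat.le_add_right _ _
      have := hα.2
      change (α.subtypeDomain fun z => ¬ z ∈ Set.range ι).degree ≤ Q - 1
      omega
    · intro α _ β _ h
      simp only [Prod.mk.injEq] at h
      ext z
      by_cases hz : z ∈ Set.range ι
      · obtain ⟨e, rfl⟩ := hz
        exact congrFun h.1 e
      · exact DFunLike.congr_fun h.2 ⟨z, hz⟩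
  refine h1.trans (le_of_eq ?_)
  rw [Finset.card_product, Fintype.card_piFinset, card_degreeLE, hY, Nat.multichoose_eq]
  simp only [Finset.card_range]
  congr 2
  omega

theorem card_le_of_exists_smul_mem_span {Λ V ι : Type*} [CommRing Λ] [IsDomain Λ]
    [AddCommGroup V] [Module Λ V] [Fintype ι] (w : ι → V) (hw : LinearIndependent Λ w)
    (s : Finset V) (h : ∀ i, ∃ d : Λ, d ≠ 0 ∧ d • w i ∈ Submodule.span Λ (s : Set V)) :
    Fintype.card ι ≤ s.card := by
  choose d hd h using h
  have hli : LinearIndependent Λ fun i => d i • w i := by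
    rw [Fintype.linearIndependent_iff] at hw ⊢
    intro c hc i
    have := hw (fun i => c i * d i) (by simpa [mul_smul] using hc) i
    exact (mul_eq_zero.mp this).resolve_right (hd i)
  have := linearIndependent_le_span_aux' _ hli (s : Set V) (by rintro _ ⟨i, rfl⟩; exact h i)
  simpa using this

section Filtration

variable {Λ 𝓕 Z J : Type*} [CommRing Λ] [CommRing 𝓕] [Algebra Λ 𝓕]

/-- The monomial of exponent `α` evaluated at `x`. -/
noncomputable def monEval (x : Z → 𝓕) (α : Z →₀ ℕ) : 𝓕 := α.prod fun z k => x z ^ k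

theorem aeval_monomial_one (x : Z → 𝓕) (α : Z →₀ ℕ) :
    aeval x (monomial α (1 : Λ)) = monEval x α := by
  simp [aeval_monomial, monEval]

theorem monEval_add (x : Z → 𝓕) (α β : Z →₀ ℕ) :
    monEval x (α + β) = monEval x α * monEval x β := by
  classical
  exact Finsupp.prod_add_index' (by simp) (by simp [pow_add])

theorem monEval_zero (x : Z → 𝓕) : monEval x 0 = 1 := Finsupp.prod_zero_index

theorem monEval_single (x : Z → 𝓕) (z : Z) : monEval x (Finsupp.single z 1) = x z := by
  simp [monEval]

variable (Λ) in
/-- The span of the products of a monomial in `x` and a monomial of degree `t` in `L`, where the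
degree in `x` is bounded by the weight of the second monomial for the weights `A - 1`, plus `c`. -/
noncomputable def weightFil (x : Z → 𝓕) (L : J → 𝓕) (A : J → ℕ) (t c : ℕ) : Submodule Λ 𝓕 :=
  Submodule.span Λ {v | ∃ (α : Z →₀ ℕ) (β : J →₀ ℕ), β.degree = t ∧
    α.degree + t ≤ (β.sum fun j k => k * A j) + c ∧ v = monEval x α * monEval L β}

variable {x : Z → 𝓕} {L : J → 𝓕} {A : J → ℕ} {t t' c c' : ℕ}

theorem one_mem_weightFil : (1 : 𝓕) ∈ weightFil Λ x L A 0 0 :=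
  Submodule.subset_span ⟨0, 0, by simp, by simp, by simp [monEval_zero]⟩

theorem mul_mem_weightFil {u v : 𝓕} (hu : u ∈ weightFil Λ x L A t c)
    (hv : v ∈ weightFil Λ x L A t' c') : u * v ∈ weightFil Λ x L A (t + t') (c + c') := by
  classical
  have h : weightFil Λ x L A t c * weightFil Λ x L A t' c' ≤
      weightFil Λ x L A (t + t') (c + c') := by
    rw [weightFil, weightFil, Submodule.span_mul_span, Submodule.span_le]
    rintro _ ⟨_, ⟨α, β, h1, h2, rfl⟩, _, ⟨α', β', h1', h2', rfl⟩, rfl⟩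
    refine Submodule.subset_span ⟨α + α', β + β', by simp [h1, h1'], ?_, ?_⟩
    · rw [Finsupp.sum_add_index' (by simp) (by simp [add_mul]), map_add]
      omega
    · simp only [monEval_add]
      ring
  exact h (Submodule.mul_mem_mul hu hv)

theorem pow_mem_weightFil {u : 𝓕} (hu : u ∈ weightFil Λ x L A t c) (k : ℕ) :
    u ^ k ∈ weightFil Λ x L A (k * t) (k * c) := by
  induction k with
  | zero => simpa using one_mem_weightFil
  | succ k ih =>
    rw [pow_succ, add_mul, add_mul, one_mul, one_mul]
    exact mul_mem_weightFil ih hu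

theorem weightFil_mono (h : c ≤ c') : weightFil Λ x L A t c ≤ weightFil Λ x L A t c' := by
  refine Submodule.span_mono ?_
  rintro _ ⟨α, β, h1, h2, rfl⟩
  exact ⟨α, β, h1, by omega, rfl⟩

theorem aeval_mul_mem_weightFil (p : MvPolynomial Z Λ) (j : J) (hp : p.totalDegree + 1 ≤ A j) :
    aeval x p * L j ∈ weightFil Λ x L A 1 0 := by
  rw [p.as_sum, map_sum, Finset.sum_mul]
  refine Submodule.sum_mem _ fun α hα => ?_
  have h1 := degree_le_of_coeff_ne_zero (mem_support_iff.mp hα)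
  have h2 : monomial α (coeff α p) = coeff α p • monomial α 1 := by
    rw [smul_monomial, smul_eq_mul, mul_one]
  rw [h2, map_smul, aeval_monomial_one, smul_mul_assoc]
  refine Submodule.smul_mem _ _ (Submodule.subset_span ⟨α, Finsupp.single j 1, by simp, ?_, ?_⟩)
  · simp
    omega
  · rw [monEval_single]

theorem monEval_mem_weightFil {Y : Type*} {Φ : Y → 𝓕} (hΦ : ∀ y, Φ y ∈ weightFil Λ x L A 1 0)
    (h1 : (1 : 𝓕) ∈ weightFil Λ x L A 1 0) (γ : Y →₀ ℕ) (hγ : γ.degree ≤ t) :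
    monEval Φ γ ∈ weightFil Λ x L A t 0 := by
  classical
  have h : monEval Φ γ ∈ weightFil Λ x L A γ.degree 0 := by
    clear hγ
    induction γ using Finsupp.induction_linear with
    | zero =>
      rw [monEval_zero, map_zero]
      exact one_mem_weightFil
    | add α β hα hβ =>
      rw [monEval_add, map_add]
      exact mul_mem_weightFil (c := 0) (c' := 0) hα hβ
    | single y k =>
      have h2 := pow_mem_weightFil (hΦ y) k
      rw [mul_one, mul_zero] at h2
      have h3 : monEval Φ (Finsupp.single y k) = Φ y ^ k := by simp [monEval]
      rw [h3, Finsupp.degree_single]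
      exact h2
  have h2 := mul_mem_weightFil h (pow_mem_weightFil h1 (t - γ.degree))
  rw [one_pow, mul_one, mul_one, mul_zero, add_zero, Nat.add_sub_cancel' hγ] at h2
  exact h2

/-- Elements of the filtration are, up to a nonzero scalar, combinations of monomials
whose exponents lie in the box. -/
theorem exists_smul_mem_span_of_mem_weightFil [IsDomain Λ] {E : Type*} [Fintype Z] [Fintype J]
    [DecidableEq J] [DecidableEq 𝓕] (ι : E → Z) (a : E → ℕ)
    (hred : ∀ q, ∃ d : Λ, d ≠ 0 ∧ ∀ α : Z →₀ ℕ, α.degree ≤ q → d • monEval x α ∈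
      Submodule.span Λ {v | ∃ β : Z →₀ ℕ, β.degree ≤ q ∧ (∀ e, β (ι e) < a e) ∧ v = monEval x β})
    (hc : c < t) {v : 𝓕} (hv : v ∈ weightFil Λ x L A t c) :
    ∃ d : Λ, d ≠ 0 ∧ d • v ∈ Submodule.span Λ
      (((Finset.univ.finsuppAntidiag t).biUnion fun β : J →₀ ℕ =>
        (boxExponents ι a (∑ j, β j * A j)).image fun α => monEval x α * monEval L β :
          Finset 𝓕) : Set 𝓕) := by
  induction hv using Submodule.span_induction with
  | mem v hv =>
    obtain ⟨α, β, h1, h2, rfl⟩ := hv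
    rw [Finsupp.sum_fintype _ _ (by simp)] at h2
    obtain ⟨d, hd, h⟩ := hred α.degree
    refine ⟨d, hd, ?_⟩
    have h3 := Submodule.mem_map_of_mem (f := LinearMap.mulRight Λ (monEval L β)) (h α le_rfl)
    rw [Submodule.map_span, LinearMap.mulRight_apply, smul_mul_assoc] at h3
    refine Submodule.span_mono ?_ h3
    rintro _ ⟨_, ⟨α', h4, h5, rfl⟩, rfl⟩
    rw [Finset.mem_coe, Finset.mem_biUnion]
    refine ⟨β, by simpa [Finsupp.degree_eq_sum] using h1, ?_⟩
    exact Finset.mem_image_of_mem _ (mem_boxExponents.mpr ⟨h5, by omega⟩)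
  | zero => exact ⟨1, one_ne_zero, by simp⟩
  | add u v _ _ hu hv =>
    obtain ⟨d, hd, hu⟩ := hu
    obtain ⟨d', hd', hv⟩ := hv
    refine ⟨d * d', mul_ne_zero hd hd', ?_⟩
    rw [smul_add]
    refine Submodule.add_mem _ ?_ ?_
    · rw [mul_comm, mul_smul]
      exact Submodule.smul_mem _ _ hu
    · rw [mul_smul]
      exact Submodule.smul_mem _ _ hv
  | smul r v _ hv =>
    obtain ⟨d, hd, hv⟩ := hv
    refine ⟨d, hd, ?_⟩
    rw [smul_comm]
    exact Submodule.smul_mem _ _ hv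

/-- Fewer box monomials than products `Φ ^ γ * θ ^ j` force an algebraic relation of degree at
most `(∏ a) * completeHom A _` for `θ` over the subalgebra generated by `Φ`. -/
theorem exists_relation [IsDomain Λ] {E : Type*} [Fintype Z] [Fintype J] [Fintype E]
    (ι : E → Z) (hι : Function.Injective ι) (a : E → ℕ)
    (hJ : Fintype.card J = Fintype.card E + 1)
    (hred : ∀ q, ∃ d : Λ, d ≠ 0 ∧ ∀ α : Z →₀ ℕ, α.degree ≤ q → d • monEval x α ∈
      Submodule.span Λ {v | ∃ β : Z →₀ ℕ, β.degree ≤ q ∧ (∀ e, β (ι e) < a e) ∧ v = monEval x β})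
    (Φ : Z → 𝓕) (hΦ : ∀ z, Φ z ∈ weightFil Λ x L A 1 0)
    (h1 : (1 : 𝓕) ∈ weightFil Λ x L A 1 0) (θ : 𝓕) (hθ : θ ∈ weightFil Λ x L A 0 1)
    (D : ℕ) (hD : D = (∏ e, a e) * completeHom A (Fintype.card Z - Fintype.card E)) :
    ∃ Q : Fin (D + 1) → MvPolynomial Z Λ, Q ≠ 0 ∧ ∑ j, aeval Φ (Q j) * θ ^ (j : ℕ) = 0 := by
  classical
  let w : (degreeLE Z (D + 1) × Fin (D + 1)) → 𝓕 := fun i => monEval Φ i.1.1 * θ ^ (i.2 : ℕ)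
  have hnot : ¬ LinearIndependent Λ w := by
    intro hw
    have hle := card_le_of_exists_smul_mem_span w hw _ fun i => by
      refine exists_smul_mem_span_of_mem_weightFil (c := D) (t := D + 1) (L := L) (A := A) ι a
        hred (Nat.lt_succ_self D) ?_
      have h2 := mul_mem_weightFil (monEval_mem_weightFil hΦ h1 i.1.1 (mem_degreeLE.mp i.1.2))
        (pow_mem_weightFil hθ i.2)
      rw [mul_zero, add_zero, mul_one, zero_add] at h2
      exact weightFil_mono (Nat.lt_succ_iff.mp i.2.2) h2
    have hcard : Fintype.card E ≤ Fintype.card Z := Fintype.card_le_of_injective ι hι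
    have hchoose : Nat.multichoose (Fintype.card Z - Fintype.card E + Fintype.card J) (D + 1) =
        (D + 1 + Fintype.card Z).choose (Fintype.card Z) := by
      rw [hJ, Nat.multichoose_eq, show Fintype.card Z - Fintype.card E + (Fintype.card E + 1) +
        (D + 1) - 1 = D + 1 + Fintype.card Z by omega, Nat.choose_symm_add]
    have hpos : 0 < (D + 1 + Fintype.card Z).choose (Fintype.card Z) :=
      Nat.choose_pos (by omega)
    have hlt : (D + 1 + Fintype.card Z).choose (Fintype.card Z) * (D + 1) ≤
        D * (D + 1 + Fintype.card Z).choose (Fintype.card Z) := by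
      calc (D + 1 + Fintype.card Z).choose (Fintype.card Z) * (D + 1)
          = Fintype.card (degreeLE Z (D + 1) × Fin (D + 1)) := by
            simp [card_degreeLE]
        _ ≤ _ := hle
        _ ≤ ∑ β ∈ Finset.univ.finsuppAntidiag (D + 1), (∏ e, a e) *
              Nat.multichoose (∑ j, β j * A j) (Fintype.card Z - Fintype.card E) := by
            refine Finset.card_biUnion_le.trans (Finset.sum_le_sum fun β _ => ?_)
            exact Finset.card_image_le.trans (card_boxExponents_le ι hι a _)
        _ ≤ (∏ e, a e) * (completeHom A (Fintype.card Z - Fintype.card E) *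
              Nat.multichoose (Fintype.card Z - Fintype.card E + Fintype.card J) (D + 1)) := by
            rw [← Finset.mul_sum]
            exact Nat.mul_le_mul_left _ (sum_multichoose_le A (D + 1) _)
        _ = D * (D + 1 + Fintype.card Z).choose (Fintype.card Z) := by
            rw [hchoose, ← mul_assoc, ← hD]
    nlinarith
  rw [Fintype.linearIndependent_iff] at hnot
  push Not at hnot
  obtain ⟨c, hc, ⟨⟨γ₀, j₀⟩, hi⟩⟩ := hnot
  refine ⟨fun j => ∑ γ : degreeLE Z (D + 1), monomial γ.1 (c (γ, j)), ?_, ?_⟩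
  · intro h
    have h2 := congrArg (coeff γ₀.1) (congrFun h j₀)
    rw [coeff_sum, Finset.sum_eq_single γ₀] at h2
    · exact hi (by simpa using h2)
    · intro γ _ hγ
      rw [coeff_monomial, if_neg]
      exact fun h3 => hγ (Subtype.ext h3)
    · simp
  · rw [Fintype.sum_prod_type_right] at hc
    rw [← hc]
    refine Finset.sum_congr rfl fun j _ => ?_
    rw [map_sum, Finset.sum_mul]
    refine Finset.sum_congr rfl fun γ _ => ?_
    simp [aeval_monomial, w, monEval, Algebra.smul_def, mul_assoc]

end Filtration

/-- The partial derivative in the direction `z` of the Lagrangian `F - ∑ λ_e g_e`, the multipliers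
`λ_e` being the variables `X (Sum.inr e)`. -/
noncomputable def lagrangeDeriv {Z E Λ : Type*} [Fintype E] [CommRing Λ] (F : MvPolynomial Z Λ)
    (g : E → MvPolynomial Z Λ) (z : Z) : MvPolynomial (Z ⊕ E) Λ :=
  rename Sum.inl (pderiv z F) - ∑ e, rename Sum.inl (pderiv z (g e)) * X (Sum.inr e)

theorem exists_relation_mem_span {Z E Λ k : Type*} [Fintype Z] [Fintype E] [CommRing Λ]
    [IsDomain Λ] [CommRing k] [Nontrivial k] (σ : Λ →+* k) (F : MvPolynomial Z Λ)
    (g : E → MvPolynomial Z Λ) (A : ℕ) (a : E → ℕ) (hA : 0 < A) (ha : ∀ e, 0 < a e)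
    (hF : F.totalDegree ≤ A) (hg : ∀ e, (g e).totalDegree ≤ a e) (ι : E → Z)
    (hι : Function.Injective ι) (hσ : ∀ e, map σ (g e) = X (ι e) ^ a e) (w : Z → Λ) (D : ℕ)
    (hD : D = (∏ e, a e) *
      completeHom (fun j : Option E => j.elim A a) (Fintype.card Z - Fintype.card E)) :
    ∃ Q : Fin (D + 1) → MvPolynomial Z Λ, Q ≠ 0 ∧
      ∑ j, aeval (lagrangeDeriv F g) (Q j) * (∑ z, C (w z) * X (Sum.inl z)) ^ (j : ℕ) ∈
        Ideal.span (Set.range fun e => rename (Sum.inl : Z → Z ⊕ E) (g e)) := by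
  classical
  let I := Ideal.span (Set.range fun e => rename (Sum.inl : Z → Z ⊕ E) (g e))
  let π : MvPolynomial (Z ⊕ E) Λ →ₐ[Λ] (MvPolynomial (Z ⊕ E) Λ ⧸ I) := Ideal.Quotient.mkₐ Λ I
  let x : Z → MvPolynomial (Z ⊕ E) Λ ⧸ I := fun z => π (X (Sum.inl z))
  let L : Option E → MvPolynomial (Z ⊕ E) Λ ⧸ I := fun j => j.elim 1 fun e => π (X (Sum.inr e))
  have hx : ∀ p : MvPolynomial Z Λ, π (rename Sum.inl p) = aeval x p := fun p => by
    have : π.comp (rename Sum.inl) = aeval x := by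
      ext z
      simp [x]
    rw [← this, AlgHom.comp_apply]
  have hgx : ∀ e, aeval x (g e) = 0 := fun e => by
    rw [← hx]
    exact Ideal.Quotient.eq_zero_iff_mem.mpr (Ideal.subset_span ⟨e, rfl⟩)
  have hred : ∀ q, ∃ d : Λ, d ≠ 0 ∧ ∀ α : Z →₀ ℕ, α.degree ≤ q → d • monEval x α ∈
      Submodule.span Λ
        {v | ∃ β : Z →₀ ℕ, β.degree ≤ q ∧ (∀ e, β (ι e) < a e) ∧ v = monEval x β} := by
    intro q
    obtain ⟨d, hd, h⟩ := exists_smul_mem_span_box σ x g hgx a ι hg hσ q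
    simp only [aeval_monomial_one] at h
    refine ⟨d, ?_, h⟩
    rintro rfl
    simp at hd
  have h1 : (1 : MvPolynomial (Z ⊕ E) Λ ⧸ I) ∈
      weightFil Λ x L (fun j : Option E => j.elim A a) 1 0 := by
    have := aeval_mul_mem_weightFil (x := x) (L := L) (A := fun j : Option E => j.elim A a)
      (1 : MvPolynomial Z Λ) none (by simp; omega)
    simpa [L] using this
  have hΦ : ∀ z, π (lagrangeDeriv F g z) ∈
      weightFil Λ x L (fun j : Option E => j.elim A a) 1 0 := by
    intro z
    rw [lagrangeDeriv, map_sub, map_sum]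
    refine Submodule.sub_mem _ ?_ (Submodule.sum_mem _ fun e _ => ?_)
    · have := aeval_mul_mem_weightFil (x := x) (L := L) (A := fun j : Option E => j.elim A a)
        (pderiv z F) none (totalDegree_pderiv_succ_le hA hF z)
      rw [hx]
      simpa [L] using this
    · rw [map_mul, hx]
      exact aeval_mul_mem_weightFil (x := x) (L := L) (A := fun j : Option E => j.elim A a)
        (pderiv z (g e)) (some e) (totalDegree_pderiv_succ_le (ha e) (hg e) z)
  have hθ : π (∑ z, C (w z) * X (Sum.inl z)) ∈
      weightFil Λ x L (fun j : Option E => j.elim A a) 0 1 := by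
    rw [map_sum]
    refine Submodule.sum_mem _ fun z _ => ?_
    rw [← smul_eq_C_mul, map_smul]
    refine Submodule.smul_mem _ _ (Submodule.subset_span ⟨Finsupp.single z 1, 0, ?_, ?_, ?_⟩)
    · simp
    · simp
    · rw [monEval_single, monEval_zero, mul_one]
  obtain ⟨Q, hQ, h⟩ := exists_relation ι hι a (by simp) hred _ hΦ h1 _ hθ D hD
  refine ⟨Q, hQ, Ideal.Quotient.eq_zero_iff_mem.mp ?_⟩
  change π _ = 0
  rw [map_sum, ← h]
  refine Finset.sum_congr rfl fun j _ => ?_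
  rw [map_mul, map_pow, ← AlgHom.comp_apply, comp_aeval]

/-- The critical points of `F` on the variety cut out by the `g e`. -/
def critSet {Z E R : Type*} [Fintype E] [CommRing R] (F : MvPolynomial Z R)
    (g : E → MvPolynomial Z R) : Set (Z → R) :=
  {z | (∀ e, eval z (g e) = 0) ∧
    ∃ lam : E → R, ∀ i, eval z (pderiv i F) = ∑ e, lam e * eval z (pderiv i (g e))}

theorem sum_eval_mul_pow_eq_zero {Z E Λ k : Type*} [Fintype Z] [Fintype E] [CommRing Λ]
    [CommRing k] (σ : Λ →+* k) (F : MvPolynomial Z Λ) (g : E → MvPolynomial Z Λ) (w : Z → Λ)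
    {N : ℕ} (Q : Fin N → MvPolynomial Z Λ)
    (h : ∑ j, aeval (lagrangeDeriv F g) (Q j) * (∑ z, C (w z) * X (Sum.inl z)) ^ (j : ℕ) ∈
        Ideal.span (Set.range fun e => rename (Sum.inl : Z → Z ⊕ E) (g e)))
    (G : MvPolynomial Z k) (c : Z → k) (hG : map σ F = G + ∑ i, C (c i) * X i) {z : Z → k}
    (hz : z ∈ critSet G fun e => map σ (g e)) :
    ∑ j, eval c (map σ (Q j)) * (∑ i, σ (w i) * z i) ^ (j : ℕ) = 0 := by
  classical
  obtain ⟨hz, lam, hlam⟩ := hz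
  let χ : MvPolynomial (Z ⊕ E) Λ →+* k := eval₂Hom σ (Sum.elim z lam)
  have hχ : ∀ p : MvPolynomial Z Λ, χ (rename Sum.inl p) = eval z (map σ p) := fun p => by
    simp only [χ, coe_eval₂Hom]
    rw [eval₂_rename, eval_map]
    rfl
  have hI : Ideal.span (Set.range fun e => rename (Sum.inl : Z → Z ⊕ E) (g e)) ≤
      RingHom.ker χ := by
    rw [Ideal.span_le]
    rintro _ ⟨e, rfl⟩
    change χ _ = 0
    rw [hχ]
    exact hz e
  have hΦ : ∀ i, χ (lagrangeDeriv F g i) = c i := fun i => by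
    rw [lagrangeDeriv, map_sub, map_sum, hχ, ← pderiv_map, hG]
    have : eval z (pderiv i (∑ i, C (c i) * X i)) = c i := by
      simp [pderiv_X, Pi.single_apply]
    rw [map_add, map_add, this, hlam i]
    simp only [map_mul, hχ, ← pderiv_map]
    simp [χ, mul_comm]
  have h2 := hI h
  change χ _ = 0 at h2
  rw [map_sum] at h2
  rw [← h2]
  refine Finset.sum_congr rfl fun j _ => ?_
  rw [map_mul, map_pow, map_sum]
  congr 2
  · have : χ.comp (aeval (lagrangeDeriv F g)).toRingHom = (eval c).comp (map σ) := by
      ext i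
      · simp [χ]
      · simp [hΦ]
    exact (congrArg (fun f => f (Q j)) this).symm
  · refine Finset.sum_congr rfl fun i _ => ?_
    simp [χ]

/-- Finitely many linear forms suffice to separate any `N` points. -/
theorem exists_linearForms_separating {k : Type*} [Field k] [CharZero k] (Z : Type*) [Fintype Z]
    (N : ℕ) : ∃ (K : ℕ) (w : ℕ → Z → k), ∀ P : Fin N → Z → k, Function.Injective P →
      ∃ t ∈ Finset.range K, Function.Injective fun i => ∑ z, w t z * P i z := by
  classical
  let e := Fintype.equivFin Z
  refine ⟨N * N * Fintype.card Z + 1, fun t z => (t : k) ^ (e z : ℕ), fun P hP => ?_⟩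
  by_contra! hcon
  let f : Fin N → Fin N → Polynomial k := fun i j =>
    ∑ z, Polynomial.C (P i z - P j z) * Polynomial.X ^ (e z : ℕ)
  have hf : ∀ i j, i ≠ j → f i j ≠ 0 := by
    intro i j hij h0
    apply hij
    apply hP
    funext z
    have := congrArg (fun q => q.coeff (e z : ℕ)) h0
    simp only [f, Polynomial.finsetSum_coeff, Polynomial.coeff_C_mul, Polynomial.coeff_X_pow,
      Polynomial.coeff_zero] at this
    rw [Finset.sum_eq_single z] at this
    · simpa [sub_eq_zero] using this
    · intro z' _ hz'
      rw [if_neg, mul_zero]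
      exact fun h => hz' (e.injective (Fin.ext h)).symm
    · simp
  have hdeg : (∏ p ∈ Finset.univ.offDiag, f p.1 p.2).natDegree < N * N * Fintype.card Z + 1 := by
    refine Nat.lt_succ_of_le ((Polynomial.natDegree_prod_le _ _).trans ?_)
    refine (Finset.sum_le_card_nsmul _ _ (Fintype.card Z) fun p _ => ?_).trans ?_
    · refine Polynomial.natDegree_sum_le_of_forall_le _ _ fun z _ => ?_
      exact (Polynomial.natDegree_C_mul_X_pow_le _ _).trans (e z).2.le
    · rw [smul_eq_mul, Finset.offDiag_card]
      refine Nat.mul_le_mul_right _ ?_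
      simp
  refine Finset.prod_ne_zero_iff.mpr (fun p hp => hf p.1 p.2 (Finset.mem_offDiag.mp hp).2.2)
    (Polynomial.eq_zero_of_natDegree_lt_card_of_eval_eq_zero _
      (f := fun t : Fin (N * N * Fintype.card Z + 1) => ((t : ℕ) : k))
      (fun s t h => Fin.ext (Nat.cast_injective h)) (fun t => ?_) (by simpa using hdeg))
  have ht := hcon t (Finset.mem_range.mpr t.2)
  rw [Function.Injective] at ht
  push Not at ht
  obtain ⟨i, j, h1, h2⟩ := ht
  rw [Polynomial.eval_prod]
  refine Finset.prod_eq_zero (i := (i, j)) (by simpa using h2) ?_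
  simp only [f, Polynomial.eval_finsetSum, Polynomial.eval_mul, Polynomial.eval_C,
    Polynomial.eval_pow, Polynomial.eval_X, sub_mul, Finset.sum_sub_distrib]
  rw [sub_eq_zero]
  simpa [mul_comm] using h1

theorem exists_linearForm_not_injective {I Z E : Type*} [Fintype Z] [Fintype E]
    (F : MvPolynomial Z (MvPolynomial I ℂ)) (g : E → MvPolynomial Z (MvPolynomial I ℂ)) (A : ℕ)
    (a : E → ℕ) (hA : 0 < A) (ha : ∀ e, 0 < a e) (hF : F.totalDegree ≤ A)
    (hg : ∀ e, (g e).totalDegree ≤ a e) (ι : E → Z) (hι : Function.Injective ι) (p₀ : I → ℂ)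
    (hp₀ : ∀ e, map (eval p₀) (g e) = X (ι e) ^ a e) (sh : (Z → ℂ) → I → ℂ)
    (hshF : ∀ p c, map (eval (p + sh c)) F = map (eval p) F + ∑ i, C (c i) * X i)
    (hshg : ∀ p c e, map (eval (p + sh c)) (g e) = map (eval p) (g e)) (w : Z → ℂ) (D : ℕ)
    (hD : D = (∏ e, a e) *
      completeHom (fun j : Option E => j.elim A a) (Fintype.card Z - Fintype.card E)) :
    ∃ ρ : MvPolynomial I ℂ, ρ ≠ 0 ∧ ∀ p, eval p ρ ≠ 0 → ∀ P : Fin (D + 1) → Z → ℂ,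
      (∀ j, P j ∈ critSet (map (eval p) F) fun e => map (eval p) (g e)) →
        ¬ Function.Injective fun j => ∑ i, w i * P j i := by
  classical
  obtain ⟨Q, hQ, hrel⟩ := exists_relation_mem_span (eval p₀) F g A a hA ha hF hg ι hι hp₀
    (fun z => C (w z)) D hD
  obtain ⟨j₀, hj₀⟩ := Function.ne_iff.mp hQ
  obtain ⟨c, hc⟩ : ∃ c : Z → ℂ, eval (fun i => C (c i)) (Q j₀) ≠ 0 := by
    by_contra! hcon
    refine hj₀ (MvPolynomial.funext_set (fun _ => Set.range C)
      (fun _ => Set.infinite_range_of_injective (C_injective I ℂ)) fun x hx => ?_)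
    choose c hc using fun i => hx i (Set.mem_univ i)
    rw [← _root_.funext hc, hcon]
    simp
  have heval : ∀ p, eval c (map (eval p) (Q j₀)) = eval p (eval (fun i => C (c i)) (Q j₀)) := by
    intro p
    have : (eval c).comp (map (eval p)) = (eval p).comp (eval fun i => C (c i)) := by
      ext i <;> simp
    exact congrArg (fun f => f (Q j₀)) this
  have hshift : ∀ p, eval p (aeval (fun i => X i + C (sh c i))
      (eval (fun i => C (c i)) (Q j₀))) = eval (p + sh c) (eval (fun i => C (c i)) (Q j₀)) := by
    intro p
    have : (eval p).comp (aeval (R := ℂ) fun i => X i + C (sh c i)).toRingHom =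
        eval (p + sh c) := by
      ext i <;> simp
    exact congrArg (fun f => f (eval (fun i => C (c i)) (Q j₀))) this
  refine ⟨aeval (fun i => X i + C (sh c i)) (eval (fun i => C (c i)) (Q j₀)), ?_, ?_⟩
  · intro h0
    refine hc (MvPolynomial.funext fun p => ?_)
    have := hshift (p - sh c)
    rw [h0, sub_add_cancel, map_zero] at this
    rw [← this, map_zero]
  · intro p hp P hP hinj
    have hp' : eval c (map (eval (p + sh c)) (Q j₀)) ≠ 0 := by
      rwa [heval, ← hshift]
    let q : Polynomial ℂ := ∑ j : Fin (D + 1),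
      Polynomial.C (eval c (map (eval (p + sh c)) (Q j))) * Polynomial.X ^ (j : ℕ)
    have hq : q.natDegree < Fintype.card (Fin (D + 1)) := by
      rw [Fintype.card_fin]
      refine Nat.lt_succ_of_le (Polynomial.natDegree_sum_le_of_forall_le _ _ fun j _ => ?_)
      exact (Polynomial.natDegree_C_mul_X_pow_le _ _).trans (Nat.lt_succ_iff.mp j.2)
    have hq0 := Polynomial.eq_zero_of_natDegree_lt_card_of_eval_eq_zero q hinj (fun j => by
      have h := sum_eval_mul_pow_eq_zero (eval (p + sh c)) F g _ Q hrel _ c (hshF p c)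
        (z := P j) (by simpa only [hshg] using hP j)
      simpa [q, Polynomial.eval_finsetSum] using h) hq
    have := congrArg (fun q => q.coeff (j₀ : ℕ)) hq0
    simp only [q, Polynomial.finsetSum_coeff, Polynomial.coeff_C_mul, Polynomial.coeff_X_pow,
      Polynomial.coeff_zero] at this
    rw [Finset.sum_eq_single j₀] at this
    · exact hp' (by simpa using this)
    · intro j _ hj
      rw [if_neg, mul_zero]
      exact fun h => hj (Fin.ext h).symm
    · simp

theorem encard_le_of_forall_not_injective {α : Type*} {s : Set α} {N : ℕ}
    (h : ∀ P : Fin (N + 1) → α, (∀ j, P j ∈ s) → ¬ Function.Injective P) : s.encard ≤ N := by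
  by_contra! hcon
  obtain ⟨t, hts, ht⟩ := Set.exists_subset_encard_eq (Order.add_one_le_of_lt hcon)
  have hfin : t.Finite := Set.finite_of_encard_eq_coe (k := N + 1) (by simpa using ht)
  have := hfin.to_subtype
  have hcard : Nat.card t = N + 1 := by
    rw [Nat.card_coe_set_eq, Set.ncard, ht]
    rfl
  let e := Finite.equivFinOfCardEq hcard
  exact h (fun j => e.symm j) (fun j => hts (e.symm j).2)
    (Subtype.val_injective.comp e.symm.injective)

/-- The critical points of a generic polynomial on a generic complete intersection. -/
theorem exists_encard_critSet_le {I Z E : Type*} [Fintype Z] [Fintype E]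
    (F : MvPolynomial Z (MvPolynomial I ℂ)) (g : E → MvPolynomial Z (MvPolynomial I ℂ)) (A : ℕ)
    (a : E → ℕ) (hA : 0 < A) (ha : ∀ e, 0 < a e) (hF : F.totalDegree ≤ A)
    (hg : ∀ e, (g e).totalDegree ≤ a e) (ι : E → Z) (hι : Function.Injective ι) (p₀ : I → ℂ)
    (hp₀ : ∀ e, map (eval p₀) (g e) = X (ι e) ^ a e) (sh : (Z → ℂ) → I → ℂ)
    (hshF : ∀ p c, map (eval (p + sh c)) F = map (eval p) F + ∑ i, C (c i) * X i)
    (hshg : ∀ p c e, map (eval (p + sh c)) (g e) = map (eval p) (g e)) :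
    ∃ ρ : MvPolynomial I ℂ, ρ ≠ 0 ∧ ∀ p, eval p ρ ≠ 0 →
      (critSet (map (eval p) F) fun e => map (eval p) (g e)).encard ≤
        ((∏ e, a e) * completeHom (fun j : Option E => j.elim A a)
          (Fintype.card Z - Fintype.card E) : ℕ) := by
  classical
  obtain ⟨D, hD⟩ : ∃ D, D = (∏ e, a e) *
    completeHom (fun j : Option E => j.elim A a) (Fintype.card Z - Fintype.card E) := ⟨_, rfl⟩
  obtain ⟨K, w, hw⟩ := exists_linearForms_separating (k := ℂ) Z (D + 1)
  choose ρ hρ h using fun t => exists_linearForm_not_injective F g A a hA ha hF hg ι hι p₀ hp₀ sh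
    hshF hshg (w t) D hD
  refine ⟨∏ t ∈ Finset.range K, ρ t, Finset.prod_ne_zero_iff.mpr fun t _ => hρ t, fun p hp => ?_⟩
  rw [← hD]
  refine encard_le_of_forall_not_injective fun P hP hinj => ?_
  obtain ⟨t, ht, hinj'⟩ := hw P hinj
  rw [map_prod, Finset.prod_ne_zero_iff] at hp
  exact h t p (hp t ht) P hP hinj'

/-- The polynomial whose coefficients at the exponents satisfying `P` are variables. -/
noncomputable def genericPoly {Z I : Type*} {P : (Z →₀ ℕ) → Prop} [Fintype {d // P d}]
    (v : {d // P d} → I) : MvPolynomial Z (MvPolynomial I ℂ) :=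
  ∑ d, monomial d.1 (X (v d))

section GenericPoly

variable {Z I : Type*} {P : (Z →₀ ℕ) → Prop} [Fintype {d // P d}] (v : {d // P d} → I)

theorem map_eval_genericPoly (p : I → ℂ) :
    map (eval p) (genericPoly v) = ∑ d, monomial d.1 (p (v d)) := by
  simp [genericPoly, map_monomial]

theorem map_eval_add_genericPoly (p q : I → ℂ) :
    map (eval (p + q)) (genericPoly v) =
      map (eval p) (genericPoly v) + map (eval q) (genericPoly v) := by
  simp [map_eval_genericPoly, Finset.sum_add_distrib]

theorem map_eval_genericPoly_eq (p : I → ℂ) (f : MvPolynomial Z ℂ) (hf : ∀ d ∈ f.support, P d)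
    (h : ∀ d, p (v d) = f.coeff d.1) : map (eval p) (genericPoly v) = f := by
  classical
  rw [map_eval_genericPoly]
  ext α
  rw [coeff_sum]
  simp only [coeff_monomial, h]
  by_cases hα : P α
  · rw [Finset.sum_eq_single ⟨α, hα⟩]
    · simp
    · intro d _ hd
      rw [if_neg]
      exact fun h' => hd (Subtype.ext h')
    · simp
  · rw [notMem_support_iff.mp fun h' => hα (hf α h')]
    refine Finset.sum_eq_zero fun d _ => ?_
    rw [if_neg]
    rintro rfl
    exact hα d.2

theorem totalDegree_genericPoly_le {q : ℕ} (h : ∀ d, P d → d.degree ≤ q) :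
    (genericPoly v).totalDegree ≤ q :=
  totalDegree_finsetSum_le fun d _ => (totalDegree_monomial_le _ _).trans (h d.1 d.2)

end GenericPoly

noncomputable instance (n a : ℕ) : Fintype (XMon n a) :=
  ((Finsupp.finite_of_degree_le (σ := Fin n) a).subset fun d (h : ∑ i, d i ≤ a) => by
    rwa [Set.mem_ofPred_eq, Finsupp.degree_eq_sum]).fintype

theorem degree_le_of_bidegree_le {n m a b : ℕ} (d : Fin n ⊕ Fin m →₀ ℕ)
    (h : (∑ i, d (Sum.inl i)) ≤ a ∧ (∑ j, d (Sum.inr j)) ≤ b) : d.degree ≤ a + b := by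
  rw [Finsupp.degree_eq_sum, Fintype.sum_sum_type]
  exact add_le_add h.1 h.2

noncomputable instance (n m a b : ℕ) : Fintype (XYMon n m a b) :=
  ((Finsupp.finite_of_degree_le (σ := Fin n ⊕ Fin m) (a + b)).subset
    fun d h => degree_le_of_bidegree_le d h).fintype

theorem sum_le_of_mem_support {n a : ℕ} {f : MvPolynomial (Fin n) ℂ} (hf : f.totalDegree ≤ a) :
    ∀ d ∈ f.support, ∑ i, d i ≤ a := fun d hd => by
  rw [← Finsupp.degree_eq_sum]
  exact (le_totalDegree hd).trans hf

/-- The indices of the coefficients of a tuple `(F, g, h)`. -/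
abbrev CoeffIdx (n m : ℕ) {l1 l2 : ℕ} (a0 b0 : ℕ) (aa : Fin l1 → ℕ) (bb : Fin l2 → ℕ) : Type :=
  XYMon n m a0 b0 ⊕ (((i : Fin l1) × XMon n (aa i)) ⊕ ((j : Fin l2) × XMon m (bb j)))

section Coefficients

variable {n m l1 l2 : ℕ} (a0 b0 : ℕ) (aa : Fin l1 → ℕ) (bb : Fin l2 → ℕ)

/-- The coefficients of `(F, g, h)`. -/
noncomputable def coeffPoint (F : MvPolynomial (Fin n ⊕ Fin m) ℂ)
    (g : Fin l1 → MvPolynomial (Fin n) ℂ) (h : Fin l2 → MvPolynomial (Fin m) ℂ) :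
    CoeffIdx n m a0 b0 aa bb → ℂ :=
  Sum.elim (fun d => F.coeff d.1)
    (Sum.elim (fun x => (g x.1).coeff x.2.1) fun x => (h x.1).coeff x.2.1)

variable (n m) in
/-- The generic objective function. -/
noncomputable def genericF :
    MvPolynomial (Fin n ⊕ Fin m) (MvPolynomial (CoeffIdx n m a0 b0 aa bb) ℂ) :=
  genericPoly (Sum.inl : XYMon n m a0 b0 → _)

variable (n m) in
/-- The generic constraint in the first group of variables. -/
noncomputable def genericG (i : Fin l1) :
    MvPolynomial (Fin n) (MvPolynomial (CoeffIdx n m a0 b0 aa bb) ℂ) :=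
  genericPoly fun d : XMon n (aa i) => Sum.inr (Sum.inl ⟨i, d⟩)

variable (n m) in
/-- The generic constraint in the second group of variables. -/
noncomputable def genericH (j : Fin l2) :
    MvPolynomial (Fin m) (MvPolynomial (CoeffIdx n m a0 b0 aa bb) ℂ) :=
  genericPoly fun d : XMon m (bb j) => Sum.inr (Sum.inr ⟨j, d⟩)

variable {a0 b0 aa bb} (F : MvPolynomial (Fin n ⊕ Fin m) ℂ)
    (g : Fin l1 → MvPolynomial (Fin n) ℂ) (h : Fin l2 → MvPolynomial (Fin m) ℂ)

theorem map_genericF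
    (hF : ∀ d ∈ F.support, (∑ i, d (Sum.inl i)) ≤ a0 ∧ (∑ j, d (Sum.inr j)) ≤ b0) :
    map (eval (coeffPoint a0 b0 aa bb F g h)) (genericF n m a0 b0 aa bb) = F :=
  map_eval_genericPoly_eq _ _ _ hF fun _ => rfl

theorem map_genericG (i : Fin l1) (hg : (g i).totalDegree ≤ aa i) :
    map (eval (coeffPoint a0 b0 aa bb F g h)) (genericG n m a0 b0 aa bb i) = g i :=
  map_eval_genericPoly_eq _ _ _ (sum_le_of_mem_support hg) fun _ => rfl

theorem map_genericH (j : Fin l2) (hh : (h j).totalDegree ≤ bb j) :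
    map (eval (coeffPoint a0 b0 aa bb F g h)) (genericH n m a0 b0 aa bb j) = h j :=
  map_eval_genericPoly_eq _ _ _ (sum_le_of_mem_support hh) fun _ => rfl

theorem totalDegree_genericF_le : (genericF n m a0 b0 aa bb).totalDegree ≤ a0 + b0 :=
  totalDegree_genericPoly_le _ degree_le_of_bidegree_le

theorem totalDegree_genericG_le (i : Fin l1) :
    (genericG n m a0 b0 aa bb i).totalDegree ≤ aa i :=
  totalDegree_genericPoly_le _ fun d hd => by rwa [Finsupp.degree_eq_sum]

theorem totalDegree_genericH_le (j : Fin l2) :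
    (genericH n m a0 b0 aa bb j).totalDegree ≤ bb j :=
  totalDegree_genericPoly_le _ fun d hd => by rwa [Finsupp.degree_eq_sum]

end Coefficients

/-- More generic polynomials than variables have no common zero. -/
theorem exists_forall_ne_zero {I E : Type*} [Fintype E] {n : ℕ}
    (g : E → MvPolynomial (Fin n) (MvPolynomial I ℂ)) (a : E → ℕ)
    (hg : ∀ e, (g e).totalDegree ≤ a e) (hn : n < Fintype.card E)
    (hspec : ∀ f : E → MvPolynomial (Fin n) ℂ, (∀ e, (f e).totalDegree ≤ a e) →
      ∃ p : I → ℂ, ∀ e, map (eval p) (g e) = f e) :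
    ∃ ρ : MvPolynomial I ℂ, ρ ≠ 0 ∧ ∀ p, eval p ρ ≠ 0 → ∀ x,
      ∃ e, eval x (map (eval p) (g e)) ≠ 0 := by
  classical
  obtain ⟨ε⟩ : Nonempty (Fin n ↪ E) :=
    Function.Embedding.nonempty_of_card_le (by simpa using hn.le)
  obtain ⟨e₀, he₀⟩ : ∃ e₀, ¬ ∃ z, ε z = e₀ := by
    by_contra! hcon
    have := Fintype.card_le_of_surjective ε hcon
    rw [Fintype.card_fin] at this
    omega
  obtain ⟨p, hp⟩ := hspec (Function.extend ε (fun z => X z ^ a (ε z)) fun _ => 1) fun e => by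
    by_cases he : ∃ z, ε z = e
    · obtain ⟨z, rfl⟩ := he
      rw [ε.injective.extend_apply, totalDegree_X_pow]
    · rw [Function.extend_apply' _ _ _ he, totalDegree_one]
      exact Nat.zero_le _
  obtain ⟨d, hd, hmem⟩ := exists_C_mem_span (eval p) g a hg ε
    (fun z => by rw [hp, ε.injective.extend_apply]) e₀
    (by rw [hp, Function.extend_apply' _ _ _ he₀])
  refine ⟨d, ?_, fun p' hp' x => ?_⟩
  · rintro rfl
    simp at hd
  · by_contra! hcon
    have hle : Ideal.span (Set.range g) ≤ RingHom.ker ((eval x).comp (map (eval p'))) := by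
      rw [Ideal.span_le]
      rintro _ ⟨e, rfl⟩
      exact hcon e
    have := hle hmem
    rw [RingHom.mem_ker, RingHom.comp_apply, map_C, eval_C] at this
    exact hp' this

/-- The summand of `boundM` belonging to the active sets `S` and `T`. -/
noncomputable def boundTerm (n m : ℕ) {l1 l2 : ℕ} (a0 b0 : ℕ) (aa : Fin l1 → ℕ) (bb : Fin l2 → ℕ)
    (S : Finset (Fin l1)) (T : Finset (Fin l2)) : ℕ :=
  if S.card ≤ n ∧ T.card ≤ m then
    (∏ i ∈ S, aa i) * (∏ j ∈ T, bb j) *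
      innerS ((a0 + b0) :: (S.toList.map aa ++ T.toList.map bb)) (n + m - S.card - T.card)
  else 0

theorem boundM_eq_sum (n m l1 l2 a0 b0 : ℕ) (aa : Fin l1 → ℕ) (bb : Fin l2 → ℕ) :
    boundM n m l1 l2 a0 b0 aa bb =
      ∑ U : Finset (Fin l1) × Finset (Fin l2), boundTerm n m a0 b0 aa bb U.1 U.2 := by
  rw [Fintype.sum_prod_type, boundM, Finset.sum_filter]
  refine Finset.sum_congr rfl fun S _ => ?_
  rw [Finset.sum_filter]
  split_ifs with hS
  · simp [boundTerm, hS]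
  · simp [boundTerm, hS]

theorem completeHom_option_sum {l1 l2 : ℕ} (A : ℕ) (aa : Fin l1 → ℕ) (bb : Fin l2 → ℕ)
    (S : Finset (Fin l1)) (T : Finset (Fin l2)) (k : ℕ) :
    completeHom (fun j : Option (S ⊕ T) => j.elim A (Sum.elim (fun i => aa i) fun j => bb j)) k =
      innerS (A :: (S.toList.map aa ++ T.toList.map bb)) k := by
  rw [innerS_eq_coeff, completeHom, Fintype.prod_option, Fintype.prod_sum_type, List.map_cons,
    List.prod_cons, List.map_append, List.prod_append, List.map_map, List.map_map,
    Finset.prod_map_toList, Finset.prod_map_toList, ← Finset.prod_coe_sort S,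
    ← Finset.prod_coe_sort T]
  rfl

/-- The active constraints, as polynomials in all the variables. -/
noncomputable def activeConstraint {n m l1 l2 : ℕ} {R : Type*} [CommRing R]
    (g : Fin l1 → MvPolynomial (Fin n) R) (h : Fin l2 → MvPolynomial (Fin m) R)
    (S : Finset (Fin l1)) (T : Finset (Fin l2)) : S ⊕ T → MvPolynomial (Fin n ⊕ Fin m) R :=
  Sum.elim (fun i => rename Sum.inl (g i)) fun j => rename Sum.inr (h j)

theorem map_activeConstraint {n m l1 l2 : ℕ} {R R' : Type*} [CommRing R] [CommRing R']
    (f : R →+* R') (g : Fin l1 → MvPolynomial (Fin n) R) (h : Fin l2 → MvPolynomial (Fin m) R)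
    (S : Finset (Fin l1)) (T : Finset (Fin l2)) (e : S ⊕ T) :
    map f (activeConstraint g h S T e) =
      activeConstraint (fun i => map f (g i)) (fun j => map f (h j)) S T e := by
  rcases e with i | j <;> simp [activeConstraint, map_rename]

section Instantiation

variable {n m l1 l2 a0 b0 : ℕ} {aa : Fin l1 → ℕ} {bb : Fin l2 → ℕ}

theorem exists_encard_critSet_active_le_of_card_le (ha0 : 0 < a0) (hb0 : 0 < b0)
    (haa : ∀ i, 0 < aa i) (hbb : ∀ j, 0 < bb j) (S : Finset (Fin l1)) (T : Finset (Fin l2))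
    (hS : S.card ≤ n) (hT : T.card ≤ m) :
    ∃ ρ : MvPolynomial (CoeffIdx n m a0 b0 aa bb) ℂ, ρ ≠ 0 ∧ ∀ p, eval p ρ ≠ 0 →
      (critSet (map (eval p) (genericF n m a0 b0 aa bb))
        (activeConstraint (fun i => map (eval p) (genericG n m a0 b0 aa bb i))
          (fun j => map (eval p) (genericH n m a0 b0 aa bb j)) S T)).encard ≤
        (boundTerm n m a0 b0 aa bb S T : ℕ) := by
  classical
  obtain ⟨ι₁⟩ : Nonempty (S ↪ Fin n) :=
    Function.Embedding.nonempty_of_card_le (by simpa using hS)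
  obtain ⟨ι₂⟩ : Nonempty (T ↪ Fin m) :=
    Function.Embedding.nonempty_of_card_le (by simpa using hT)
  let p₀ : CoeffIdx n m a0 b0 aa bb → ℂ := coeffPoint a0 b0 aa bb 0
    (fun i => if hi : i ∈ S then X (ι₁ ⟨i, hi⟩) ^ aa i else 0)
    fun j => if hj : j ∈ T then X (ι₂ ⟨j, hj⟩) ^ bb j else 0
  let sh : (Fin n ⊕ Fin m → ℂ) → CoeffIdx n m a0 b0 aa bb → ℂ := fun c =>
    coeffPoint a0 b0 aa bb (∑ z, C (c z) * X z) 0 0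
  have hlin : ∀ c : Fin n ⊕ Fin m → ℂ, ∀ d ∈ (∑ z, C (c z) * X z).support,
      (∑ i, d (Sum.inl i)) ≤ a0 ∧ (∑ j, d (Sum.inr j)) ≤ b0 := by
    intro c d hd
    obtain ⟨z, hz⟩ : ∃ z, Finsupp.single z 1 = d := by
      by_contra! hcon
      rw [mem_support_iff] at hd
      exact hd (by simp [coeff_sum, coeff_C_mul, coeff_X, hcon])
    subst hz
    rcases z with z | z <;> simp [Finsupp.single_apply, Nat.succ_le_of_lt, ha0, hb0]
  have key := exists_encard_critSet_le (genericF n m a0 b0 aa bb)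
    (activeConstraint (genericG n m a0 b0 aa bb) (genericH n m a0 b0 aa bb) S T) (a0 + b0)
    (Sum.elim (fun i => aa i) fun j => bb j) (by omega)
    (by rintro (i | j); exacts [haa i, hbb j]) totalDegree_genericF_le
    (by
      rintro (i | j)
      · exact (totalDegree_rename_le _ _).trans (totalDegree_genericG_le _)
      · exact (totalDegree_rename_le _ _).trans (totalDegree_genericH_le _))
    (Sum.map ι₁ ι₂) (ι₁.injective.sumMap ι₂.injective) p₀
    (by
      intro e
      rw [map_activeConstraint]
      rcases e with i | j
      · simp only [activeConstraint, Sum.elim_inl, Sum.map_inl, p₀]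
        rw [map_genericG]
        · simp
        · simp
      · simp only [activeConstraint, Sum.elim_inr, Sum.map_inr, p₀]
        rw [map_genericH]
        · simp
        · simp)
    sh
    (fun p c => by
      rw [genericF, map_eval_add_genericPoly, ← genericF, map_genericF _ _ _ (hlin c)])
    (fun p c e => by
      rw [map_activeConstraint, map_activeConstraint]
      congr 1
      · funext i
        rw [genericG, map_eval_add_genericPoly, ← genericG, map_genericG _ _ _ _ (by simp)]
        simp
      · funext j
        rw [genericH, map_eval_add_genericPoly, ← genericH, map_genericH _ _ _ _ (by simp)]
        simp)
  obtain ⟨ρ, hρ, h⟩ := key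
  refine ⟨ρ, hρ, fun p hp => ?_⟩
  have h2 := h p hp
  simp only [map_activeConstraint] at h2
  refine h2.trans (le_of_eq ?_)
  rw [boundTerm, if_pos ⟨hS, hT⟩, completeHom_option_sum, Fintype.prod_sum_type,
    ← Finset.prod_coe_sort S aa, ← Finset.prod_coe_sort T bb]
  simp [Nat.sub_sub]

theorem exists_encard_critSet_active_le (ha0 : 0 < a0) (hb0 : 0 < b0) (haa : ∀ i, 0 < aa i)
    (hbb : ∀ j, 0 < bb j) (S : Finset (Fin l1)) (T : Finset (Fin l2)) :
    ∃ ρ : MvPolynomial (CoeffIdx n m a0 b0 aa bb) ℂ, ρ ≠ 0 ∧ ∀ p, eval p ρ ≠ 0 →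
      (critSet (map (eval p) (genericF n m a0 b0 aa bb))
        (activeConstraint (fun i => map (eval p) (genericG n m a0 b0 aa bb i))
          (fun j => map (eval p) (genericH n m a0 b0 aa bb j)) S T)).encard ≤
        (boundTerm n m a0 b0 aa bb S T : ℕ) := by
  classical
  by_cases hS : S.card ≤ n
  · by_cases hT : T.card ≤ m
    · exact exists_encard_critSet_active_le_of_card_le ha0 hb0 haa hbb S T hS hT
    obtain ⟨ρ, hρ, h⟩ := exists_forall_ne_zero (fun j : T => genericH n m a0 b0 aa bb j)
      (fun j => bb j) (fun j => totalDegree_genericH_le _) (by simpa using hT) fun f hf =>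
        ⟨coeffPoint a0 b0 aa bb 0 0 fun j => if hj : j ∈ T then f ⟨j, hj⟩ else 0, fun j => by
          rw [map_genericH] <;> simp [hf]⟩
    refine ⟨ρ, hρ, fun p hp => ?_⟩
    suffices hempty : critSet (map (eval p) (genericF n m a0 b0 aa bb))
        (activeConstraint (fun i => map (eval p) (genericG n m a0 b0 aa bb i))
          (fun j => map (eval p) (genericH n m a0 b0 aa bb j)) S T) = ∅ by
      simp [hempty]
    refine Set.eq_empty_of_forall_notMem fun z hz => ?_
    obtain ⟨j, hj⟩ := h p hp (z ∘ Sum.inr)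
    refine hj ?_
    have := hz.1 (Sum.inr j)
    rwa [activeConstraint, Sum.elim_inr, eval_rename] at this
  · obtain ⟨ρ, hρ, h⟩ := exists_forall_ne_zero (fun i : S => genericG n m a0 b0 aa bb i)
      (fun i => aa i) (fun i => totalDegree_genericG_le _) (by simpa using hS) fun f hf =>
        ⟨coeffPoint a0 b0 aa bb 0 (fun i => if hi : i ∈ S then f ⟨i, hi⟩ else 0) 0, fun i => by
          rw [map_genericG] <;> simp [hf]⟩
    refine ⟨ρ, hρ, fun p hp => ?_⟩
    suffices hempty : critSet (map (eval p) (genericF n m a0 b0 aa bb))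
        (activeConstraint (fun i => map (eval p) (genericG n m a0 b0 aa bb i))
          (fun j => map (eval p) (genericH n m a0 b0 aa bb j)) S T) = ∅ by
      simp [hempty]
    refine Set.eq_empty_of_forall_notMem fun z hz => ?_
    obtain ⟨i, hi⟩ := h p hp (z ∘ Sum.inl)
    refine hi ?_
    have := hz.1 (Sum.inl i)
    rwa [activeConstraint, Sum.elim_inl, eval_rename] at this

end Instantiation

theorem pderiv_rename_of_notMem_range_s4 {Z Y R : Type*} [CommSemiring R] {f : Z → Y} {y : Y}
    (hy : y ∉ Set.range f) (p : MvPolynomial Z R) : pderiv y (rename f p) = 0 := by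
  classical
  refine pderiv_eq_zero_of_notMem_vars fun h => ?_
  obtain ⟨z, -, rfl⟩ := Finset.mem_image.mp (vars_rename f p h)
  exact hy ⟨z, rfl⟩

theorem SadSys.mem_critSet {n m l1 l2 : ℕ} {E1X E2X : Finset (Fin l1)} {E1Y E2Y : Finset (Fin l2)}
    (hX : E1X ∪ E2X = Finset.univ) (hY : E1Y ∪ E2Y = Finset.univ)
    {F : MvPolynomial (Fin n ⊕ Fin m) ℂ} {g : Fin l1 → MvPolynomial (Fin n) ℂ}
    {h : Fin l2 → MvPolynomial (Fin m) ℂ} {x : Fin n → ℂ} {y : Fin m → ℂ} {lam : Fin l1 → ℂ}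
    {mu : Fin l2 → ℂ} (H : SadSys E1X E2X E1Y E2Y F g h x y lam mu) :
    Sum.elim x y ∈ critSet F (activeConstraint g h {i | eval x (g i) = 0}
      {j | eval y (h j) = 0}) := by
  obtain ⟨hx, hy, h1, h2, h3, h4⟩ := H
  have hlam : ∀ i, eval x (g i) ≠ 0 → lam i = 0 := fun i hi => by
    rcases Finset.mem_union.mp (hX ▸ Finset.mem_univ i) with hE | hE
    · exact absurd (h1 i hE) hi
    · exact (mul_eq_zero.mp (h2 i hE)).resolve_right hi
  have hmu : ∀ j, eval y (h j) ≠ 0 → mu j = 0 := fun j hj => by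
    rcases Finset.mem_union.mp (hY ▸ Finset.mem_univ j) with hE | hE
    · exact absurd (h3 j hE) hj
    · exact (mul_eq_zero.mp (h4 j hE)).resolve_right hj
  refine ⟨?_, Sum.elim (fun i => lam i) fun j => mu j, ?_⟩
  · rintro (⟨i, hi⟩ | ⟨j, hj⟩)
    · rw [activeConstraint, Sum.elim_inl, eval_rename, Sum.elim_comp_inl]
      simpa using hi
    · rw [activeConstraint, Sum.elim_inr, eval_rename, Sum.elim_comp_inr]
      simpa using hj
  · rintro (i | j)
    · rw [hx, Fintype.sum_sum_type]
      simp only [activeConstraint, Sum.elim_inl, Sum.elim_inr, pderiv_rename Sum.inl_injective,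
        pderiv_rename_of_notMem_range_s4 (f := Sum.inr) (y := Sum.inl i) (by simp), eval_rename,
        Sum.elim_comp_inl, map_zero, mul_zero, Finset.sum_const_zero, add_zero]
      rw [Finset.sum_coe_sort _ fun k => lam k * eval x (pderiv i (g k))]
      refine (Finset.sum_subset (Finset.subset_univ _) fun k _ hk => ?_).symm
      rw [hlam k (by simpa using hk), zero_mul]
    · rw [hy, Fintype.sum_sum_type]
      simp only [activeConstraint, Sum.elim_inl, Sum.elim_inr, pderiv_rename Sum.inr_injective,
        pderiv_rename_of_notMem_range_s4 (f := Sum.inl) (y := Sum.inr j) (by simp), eval_rename,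
        Sum.elim_comp_inr, map_zero, mul_zero, Finset.sum_const_zero, zero_add]
      rw [Finset.sum_coe_sort _ fun k => mu k * eval y (pderiv j (h k))]
      refine (Finset.sum_subset (Finset.subset_univ _) fun k _ hk => ?_).symm
      rw [hmu k (by simpa using hk), zero_mul]

/-- For generic `F, g, h` with the given degree bounds, the set of points
`(x, y) ∈ ℂⁿ × ℂᵐ` admitting multipliers `λ, μ` solving the critical-point
system (3.3) has cardinality at most `M`. -/
theorem stmt4 (n m l1 l2 : ℕ) (a0 b0 : ℕ) (aa : Fin l1 → ℕ) (bb : Fin l2 → ℕ)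
    (ha0 : 0 < a0) (hb0 : 0 < b0) (haa : ∀ i, 0 < aa i) (hbb : ∀ j, 0 < bb j)
    (E1X E2X : Finset (Fin l1)) (hXu : E1X ∪ E2X = Finset.univ) (hXd : Disjoint E1X E2X)
    (E1Y E2Y : Finset (Fin l2)) (hYu : E1Y ∪ E2Y = Finset.univ) (hYd : Disjoint E1Y E2Y) :
    ∃ ρ : MvPolynomial
        (XYMon n m a0 b0 ⊕ (((i : Fin l1) × XMon n (aa i)) ⊕ ((j : Fin l2) × XMon m (bb j)))) ℂ,
      ρ ≠ 0 ∧
      ∀ (F : MvPolynomial (Fin n ⊕ Fin m) ℂ)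
        (g : Fin l1 → MvPolynomial (Fin n) ℂ) (h : Fin l2 → MvPolynomial (Fin m) ℂ),
        (∀ d ∈ F.support, (∑ i, d (Sum.inl i)) ≤ a0 ∧ (∑ j, d (Sum.inr j)) ≤ b0) →
        (∀ i, (g i).totalDegree ≤ aa i) → (∀ j, (h j).totalDegree ≤ bb j) →
        eval (fun idx =>
          match idx with
          | Sum.inl d => F.coeff d.1
          | Sum.inr (Sum.inl ⟨i, d⟩) => (g i).coeff d.1
          | Sum.inr (Sum.inr ⟨j, d⟩) => (h j).coeff d.1) ρ ≠ 0 →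
        ({q : (Fin n → ℂ) × (Fin m → ℂ) |
            ∃ lam mu, SadSys E1X E2X E1Y E2Y F g h q.1 q.2 lam mu}.Finite ∧
         {q : (Fin n → ℂ) × (Fin m → ℂ) |
            ∃ lam mu, SadSys E1X E2X E1Y E2Y F g h q.1 q.2 lam mu}.ncard ≤
              boundM n m l1 l2 a0 b0 aa bb) := by
  classical
  choose ρ hρ hbound using fun U : Finset (Fin l1) × Finset (Fin l2) =>
    exists_encard_critSet_active_le (n := n) (m := m) ha0 hb0 haa hbb U.1 U.2
  refine ⟨∏ U, ρ U, Finset.prod_ne_zero_iff.mpr fun U _ => hρ U, fun F g h hF hg hh hne => ?_⟩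
  have hpt : eval (coeffPoint a0 b0 aa bb F g h) (∏ U, ρ U) ≠ 0 := by
    refine fun h0 => hne ?_
    rw [← h0]
    congr 2
    funext idx
    rcases idx with d | ⟨i, d⟩ | ⟨j, d⟩ <;> rfl
  rw [map_prod, Finset.prod_ne_zero_iff] at hpt
  have hcrit := fun U => hbound U _ (hpt U (Finset.mem_univ U))
  simp only [map_genericF F g h hF, map_genericG F g h _ (hg _), map_genericH F g h _ (hh _)]
    at hcrit
  have hle : {q : (Fin n → ℂ) × (Fin m → ℂ) |
      ∃ lam mu, SadSys E1X E2X E1Y E2Y F g h q.1 q.2 lam mu}.encard ≤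
        (boundM n m l1 l2 a0 b0 aa bb : ℕ) := by
    calc _ ≤ (⋃ U : Finset (Fin l1) × Finset (Fin l2),
          critSet F (activeConstraint g h U.1 U.2)).encard := by
          refine Set.encard_le_encard_of_injOn (f := fun q => Sum.elim q.1 q.2) ?_ ?_
          · rintro q ⟨lam, mu, H⟩
            exact Set.mem_iUnion.mpr ⟨(_, _), H.mem_critSet hXu hYu⟩
          · intro q _ q' _ hqq
            exact Prod.ext (congrArg (fun f => f ∘ Sum.inl) hqq)
              (congrArg (fun f => f ∘ Sum.inr) hqq)
      _ ≤ ∑ U : Finset (Fin l1) × Finset (Fin l2),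
          (critSet F (activeConstraint g h U.1 U.2)).encard := Set.encard_iUnion_le_of_fintype _
      _ ≤ ∑ U : Finset (Fin l1) × Finset (Fin l2),
          ((boundTerm n m a0 b0 aa bb U.1 U.2 : ℕ) : ℕ∞) :=
          Finset.sum_le_sum fun U _ => hcrit U
      _ = _ := by rw [boundM_eq_sum, Nat.cast_sum]
  obtain ⟨hfin, N, hN, hNle⟩ := Set.encard_le_coe_iff.mp hle
  refine ⟨hfin, ?_⟩
  rw [Set.ncard, hN]
  simpa using hNle
end
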